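/- Let J ⊆ ∘I be nonempty. The assignment (K, u, y) ↦ ∇_J(K, u, y) = Δ^K_J(u, −) ⊔ uΦ_K(y) defines a bijection from P̃_J onto 𝔅_J ⊔ 𝔅^∞_J (the collection of all biconvex sets in Δ_{J+} that are either finite or infinite real), and this bijection maps P_J onto 𝔅^∞_J. -/

import Mathlib

open scoped Pointwise

section

variable {ι V : Type*} [Fintype ι] [Nonempty ι] [AddCommGroup V] [Module ℝ V]

/-- The length of `w` with respect to a generating set `S` of a group. -/
noncomputable def lenG {G : Type*} [Group G] (S : Set G) (w : G) : ℕ :=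
  sInf {n | ∃ l : List G, (∀ x ∈ l, x ∈ S) ∧ l.length = n ∧ l.prod = w}

/-- `v` is a nonnegative linear combination of the simple roots `α` of `∘Δ`. -/
def PosoComb (α : ι → V) (v : V) : Prop :=
  ∃ c : ι → ℝ, (∀ i, 0 ≤ c i) ∧ v = ∑ i, c i • α i

/-- The parabolic subgroup `∘W_J = ⟨s_j | j ∈ J⟩` of the finite Weyl group, realized
inside the group of linear automorphisms of `𝔥* = V`. -/
def WoJ (α : ι → V) (s : V → V ≃ₗ[ℝ] V) (J : Set ι) : Subgroup (V ≃ₗ[ℝ] V) :=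
  Subgroup.closure ((fun j => s (α j)) '' J)

/-- `∘Δ_J = ∘W_J(∘Π_J)` (so `∘Δ_∅ = ∅`). -/
def DeloJ (α : ι → V) (s : V → V ≃ₗ[ℝ] V) (J : Set ι) : Set V :=
  {v | ∃ g ∈ WoJ α s J, ∃ j ∈ J, v = g (α j)}

/-- `∘Δ`, the root system of the underlying finite-dimensional simple Lie algebra. -/
def Delo (α : ι → V) (s : V → V ≃ₗ[ℝ] V) : Set V := DeloJ α s Set.univ

/-- `∘Δ^K_{J+} = (∘Δ_J ∖ ∘Δ_K) ∩ ∘Δ₊`. -/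
def DeloKJpos (α : ι → V) (s : V → V ≃ₗ[ℝ] V) (J K : Set ι) : Set V :=
  (DeloJ α s J \ DeloJ α s K) ∩ {v | PosoComb α v}

/-- `∘Δ^K_{J−} = (∘Δ_J ∖ ∘Δ_K) ∩ ∘Δ₋`. -/
def DeloKJneg (α : ι → V) (s : V → V ≃ₗ[ℝ] V) (J K : Set ι) : Set V :=
  (DeloJ α s J \ DeloJ α s K) ∩ {v | PosoComb α (-v)}

/-- The set `∘W^K_J` of minimal-length representatives of the right cosets `∘W_J/∘W_K`. -/
def MinReps (α : ι → V) (s : V → V ≃ₗ[ℝ] V) (J K : Set ι) : Set (V ≃ₗ[ℝ] V) :=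
  {w | w ∈ WoJ α s J ∧ ∀ v ∈ WoJ α s K,
    lenG (Set.range fun i => s (α i)) w ≤ lenG (Set.range fun i => s (α i)) (w * v)}

/-- The affine simple roots `Π = {α₀ = δ − θ} ∪ ∘Π`, indexed by `Option ι`. -/
def alHat (α : ι → V) (δ θ : V) : Option ι → V := fun o => o.elim (δ - θ) α

/-- `v` is a nonnegative linear combination of the affine simple roots. -/
def PosComb (α : ι → V) (δ θ : V) (v : V) : Prop :=
  ∃ c : Option ι → ℝ, (∀ o, 0 ≤ c o) ∧ v = ∑ o, c o • alHat α δ θ o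

/-- The real roots `Δ^re = {mδ + ε | m ∈ ℤ, ε ∈ ∘Δ}`. -/
def DelRe (α : ι → V) (δ : V) (s : V → V ≃ₗ[ℝ] V) : Set V :=
  {v | ∃ m : ℤ, ∃ ε ∈ Delo α s, v = m • δ + ε}

/-- The imaginary roots `Δ^im = {mδ | m ∈ ℤ ∖ {0}}`. -/
def DelIm (δ : V) : Set V := {v | ∃ m : ℤ, m ≠ 0 ∧ v = m • δ}

/-- The affine root system `Δ = Δ^re ∪ Δ^im`. -/
def Del (α : ι → V) (δ : V) (s : V → V ≃ₗ[ℝ] V) : Set V := DelRe α δ s ∪ DelIm δ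

/-- The positive roots `Δ₊` (relative to `Π`). -/
def DelPos (α : ι → V) (δ θ : V) (s : V → V ≃ₗ[ℝ] V) : Set V :=
  {v ∈ Del α δ s | PosComb α δ θ v}

/-- The negative roots `Δ₋ = −Δ₊`. -/
def DelNeg (α : ι → V) (δ θ : V) (s : V → V ≃ₗ[ℝ] V) : Set V :=
  {v | -v ∈ DelPos α δ θ s}

/-- `Δ^re₊ = Δ^re ∩ Δ₊`. -/
def DelRePos (α : ι → V) (δ θ : V) (s : V → V ≃ₗ[ℝ] V) : Set V :=
  DelRe α δ s ∩ DelPos α δ θ s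

/-- `Δ^im₊ = {mδ | m ≥ 1}`. -/
def DelImPos (δ : V) : Set V := {v | ∃ m : ℕ, 0 < m ∧ v = (m : ℤ) • δ}

/-- `⟨ε⟩ = {mδ + ε | m ∈ ℤ≥0} ∩ Δ^re₊`. -/
def brkt (α : ι → V) (δ θ : V) (s : V → V ≃ₗ[ℝ] V) (ε : V) : Set V :=
  {v | ∃ m : ℕ, v = (m : ℤ) • δ + ε} ∩ DelRePos α δ θ s

/-- `⟨P⟩ = ⋃_{ε ∈ P} ⟨ε⟩`. -/
def brSet (α : ι → V) (δ θ : V) (s : V → V ≃ₗ[ℝ] V) (P : Set V) : Set V :=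
  ⋃ ε ∈ P, brkt α δ θ s ε

/-- `Δ^re_J = {mδ + ε | m ∈ ℤ, ε ∈ ∘Δ_J}`. -/
def DelReJ (α : ι → V) (δ : V) (s : V → V ≃ₗ[ℝ] V) (J : Set ι) : Set V :=
  {v | ∃ m : ℤ, ∃ ε ∈ DeloJ α s J, v = m • δ + ε}

/-- `Δ_J = Δ^re_J ∪ Δ^im`. -/
def DelJ (α : ι → V) (δ : V) (s : V → V ≃ₗ[ℝ] V) (J : Set ι) : Set V :=
  DelReJ α δ s J ∪ DelIm δ

/-- `Δ_{J+} = Δ_J ∩ Δ₊`. -/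
def DelJPos (α : ι → V) (δ θ : V) (s : V → V ≃ₗ[ℝ] V) (J : Set ι) : Set V :=
  DelJ α δ s J ∩ DelPos α δ θ s

/-- `Δ_{J+} = ⟨∘Δ_J⟩ ∪ Δ^im₊` (the description used from Section 5 onwards). -/
def DelJPosB (α : ι → V) (δ θ : V) (s : V → V ≃ₗ[ℝ] V) (J : Set ι) : Set V :=
  brSet α δ θ s (DeloJ α s J) ∪ DelImPos δ

/-- The set of highest roots of the irreducible components of `∘Δ_J`, i.e. the maximal
elements of `∘Δ_{J+}`: the positive roots `ε` of `∘Δ_J` such that no `ε + α_j` is a root. -/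
def HighRoots (α : ι → V) (s : V → V ≃ₗ[ℝ] V) (J : Set ι) : Set V :=
  {ε ∈ DeloJ α s J | PosoComb α ε ∧ ∀ j ∈ J, ε + α j ∉ DeloJ α s J}

/-- `Π_J = ∘Π_J ⊔ {δ − θ_{J_c} | c}`. -/
def PiJ (α : ι → V) (δ : V) (s : V → V ≃ₗ[ℝ] V) (J : Set ι) : Set V :=
  (α '' J) ∪ (fun x => δ - x) '' HighRoots α s J

/-- `S_J = {s_α | α ∈ Π_J}`. -/
def SJ (α : ι → V) (δ : V) (s : V → V ≃ₗ[ℝ] V) (J : Set ι) : Set (V ≃ₗ[ℝ] V) :=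
  s '' PiJ α δ s J

/-- `W_J = ⟨S_J⟩` (so `W_∅ = {1}`). -/
def WJ (α : ι → V) (δ : V) (s : V → V ≃ₗ[ℝ] V) (J : Set ι) : Subgroup (V ≃ₗ[ℝ] V) :=
  Subgroup.closure (SJ α δ s J)

/-- `Φ_J(y) = {β ∈ Δ_{J+} | y⁻¹(β) < 0}`, with `Δ_{J+} = Δ_J ∩ Δ₊`. -/
def PhiJ (α : ι → V) (δ θ : V) (s : V → V ≃ₗ[ℝ] V) (J : Set ι) (y : V ≃ₗ[ℝ] V) : Set V :=
  {β ∈ DelJPos α δ θ s J | y⁻¹ β ∈ DelNeg α δ θ s}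

/-- `Φ_J(y) = {β ∈ Δ_{J+} | y⁻¹(β) < 0}`, with `Δ_{J+} = ⟨∘Δ_J⟩ ∪ Δ^im₊`. -/
def PhiJb (α : ι → V) (δ θ : V) (s : V → V ≃ₗ[ℝ] V) (J : Set ι) (y : V ≃ₗ[ℝ] V) : Set V :=
  {β ∈ DelJPosB α δ θ s J | y⁻¹ β ∈ DelNeg α δ θ s}

/-- `Δ^K_J(u, −) = ⟨u∘Δ^K_{J−}⟩`. -/
def DKJm (α : ι → V) (δ θ : V) (s : V → V ≃ₗ[ℝ] V) (J K : Set ι) (u : V ≃ₗ[ℝ] V) : Set V :=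
  brSet α δ θ s (⇑u '' DeloKJneg α s J K)

/-- `Δ^K_J(u, +) = ⟨u∘Δ^K_{J+}⟩`. -/
def DKJp (α : ι → V) (δ θ : V) (s : V → V ≃ₗ[ℝ] V) (J K : Set ι) (u : V ≃ₗ[ℝ] V) : Set V :=
  brSet α δ θ s (⇑u '' DeloKJpos α s J K)

/-- `B` is a convex set in `A`: `B ⊆ A` and `β, γ ∈ B`, `β + γ ∈ A` imply `β + γ ∈ B`. -/
def ConvexIn (A B : Set V) : Prop :=
  B ⊆ A ∧ ∀ x ∈ B, ∀ y ∈ B, x + y ∈ A → x + y ∈ B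

/-- `B` is a biconvex set in `A`: both `B` and `A ∖ B` are convex sets in `A`. -/
def BiconvexIn (A B : Set V) : Prop :=
  ConvexIn A B ∧ ConvexIn A (A \ B)

/-- `P ⊆ ∘Δ` is a closed set. -/
def ClosedIn (Δo P : Set V) : Prop :=
  ∀ ε ∈ P, ∀ η ∈ P, ε + η ∈ Δo → ε + η ∈ P

/-- The coroot `α_j^∨ = 2α_j/(α_j|α_j)`. -/
noncomputable def coroot (α : ι → V) (B : V →ₗ[ℝ] V →ₗ[ℝ] ℝ) (j : ι) : V :=
  (2 / B (α j) (α j)) • α j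

/-- The coroot lattice `∘Q^∨_J = ⊕_{j ∈ J} ℤ α_j^∨`. -/
def QJ (α : ι → V) (B : V →ₗ[ℝ] V →ₗ[ℝ] ℝ) (J : Set ι) : Set V :=
  {lam | ∃ c : ι → ℤ, (∀ j, j ∉ J → c j = 0) ∧ lam = ∑ j, c j • coroot α B j}

/-- `g` acts as the translation `t_λ`: `g(μ) = μ − (μ|λ)δ` for `μ` in the span of `Π`. -/
def IsTransl (α : ι → V) (δ θ : V) (B : V →ₗ[ℝ] V →ₗ[ℝ] ℝ) (lam : V)
    (g : V ≃ₗ[ℝ] V) : Prop :=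
  ∀ μ ∈ Submodule.span ℝ (Set.range (alHat α δ θ)), g μ = μ - B μ lam • δ

/-- The translation subgroup `T_J = {t_λ | λ ∈ ∘Q^∨_J}` of `W_J`. -/
def TJ (α : ι → V) (δ θ : V) (B : V →ₗ[ℝ] V →ₗ[ℝ] ℝ) (s : V → V ≃ₗ[ℝ] V)
    (J : Set ι) : Set (V ≃ₗ[ℝ] V) :=
  {g | g ∈ WJ α δ s J ∧ ∃ lam ∈ QJ α B J, IsTransl α δ θ B lam g}

/-- The hypotheses describing the root datum of an untwisted affine Kac–Moody Lie algebra
over `ℝ`: `α` are the simple roots of the underlying finite-dimensional simple Lie algebra,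
`δ` is the null root, `θ` the highest root of `∘Δ`, `B` the standard invariant bilinear form,
and `s a` the reflection in a (real) root `a`. -/
structure AffineSetup (α : ι → V) (δ θ : V) (B : V →ₗ[ℝ] V →ₗ[ℝ] ℝ)
    (s : V → V ≃ₗ[ℝ] V) : Prop where
  indep : LinearIndependent ℝ (alHat α δ θ)
  Bsymm : ∀ u v : V, B u v = B v u
  Bpos : ∀ v ∈ Delo α s, 0 < B v v
  refl_def : ∀ a : V, B a a ≠ 0 → ∀ v : V, s a v = v - (2 * B v a / B a a) • a
  delta_orth : ∀ i : ι, B δ (α i) = 0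
  delta_null : B δ δ = 0
  theta_high : θ ∈ HighRoots α s Set.univ
  cryst : ∀ i : ι, ∀ v ∈ Delo α s, ∃ m : ℤ, s (α i) v = v - m • α i
  base : ∀ v ∈ Delo α s, Xor' (PosoComb α v) (PosoComb α (-v))
  finite : (Delo α s).Finite
  reduced : ∀ v ∈ Delo α s, (2 : ℝ) • v ∉ Delo α s
  irred : ∀ A : Set ι, (∀ i ∈ A, ∀ j ∈ Aᶜ, s (α i) (α j) = α j) → A = ∅ ∨ A = Set.univ

end

section
set_option linter.unusedSectionVars false
variable {ι V : Type*} [Fintype ι] [Nonempty ι] [AddCommGroup V] [Module ℝ V]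

section basics
variable {α : ι → V} {δ θ : V} {B : V →ₗ[ℝ] V →ₗ[ℝ] ℝ} {s : V → V ≃ₗ[ℝ] V}

/-- the pairing `⟨v, a^∨⟩` -/
noncomputable def prL (B : V →ₗ[ℝ] V →ₗ[ℝ] ℝ) (a : V) : V →ₗ[ℝ] ℝ := (2 / B a a) • B.flip a

lemma prL_apply (a v : V) : prL B a v = 2 / B a a * B v a := by
  simp [prL]

lemma WoJ_mono {J K : Set ι} (hJK : J ⊆ K) : WoJ α s J ≤ WoJ α s K :=
  Subgroup.closure_mono (Set.image_mono hJK)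

lemma gen_mem {J : Set ι} {j : ι} (hj : j ∈ J) : s (α j) ∈ WoJ α s J :=
  Subgroup.subset_closure ⟨j, hj, rfl⟩

lemma alpha_memJ {J : Set ι} {j : ι} (hj : j ∈ J) : α j ∈ DeloJ α s J :=
  ⟨1, one_mem _, j, hj, rfl⟩

lemma alpha_mem (j : ι) : α j ∈ Delo α s := alpha_memJ (Set.mem_univ j)

lemma DeloJ_mono {J K : Set ι} (hJK : J ⊆ K) : DeloJ α s J ⊆ DeloJ α s K := by
  rintro v ⟨g, hg, j, hj, rfl⟩
  exact ⟨g, WoJ_mono hJK hg, j, hJK hj, rfl⟩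

lemma DeloJ_sub {J : Set ι} : DeloJ α s J ⊆ Delo α s := DeloJ_mono (Set.subset_univ _)

lemma DeloJ_act {J : Set ι} {g : V ≃ₗ[ℝ] V} (hg : g ∈ WoJ α s J) {v : V} (hv : v ∈ DeloJ α s J) :
    g v ∈ DeloJ α s J := by
  obtain ⟨k, hk, j, hj, rfl⟩ := hv
  exact ⟨g * k, mul_mem hg hk, j, hj, rfl⟩

lemma DeloJ_act_iff {J : Set ι} {g : V ≃ₗ[ℝ] V} (hg : g ∈ WoJ α s J) {v : V} :
    g v ∈ DeloJ α s J ↔ v ∈ DeloJ α s J := by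
  refine ⟨fun hv => ?_, DeloJ_act hg⟩
  have := DeloJ_act (inv_mem hg) hv
  rwa [show g⁻¹ (g v) = v from g.symm_apply_apply v] at this

lemma wo_univ {J : Set ι} {g : V ≃ₗ[ℝ] V} (hg : g ∈ WoJ α s J) : g ∈ WoJ α s Set.univ :=
  WoJ_mono (Set.subset_univ _) hg

namespace AffineSetup
variable (h : AffineSetup α δ θ B s)
include h

lemma Bne {a : V} (ha : a ∈ Delo α s) : B a a ≠ 0 := (h.Bpos a ha).ne'

lemma s_gen {a : V} (ha : B a a ≠ 0) (v : V) : s a v = v - prL B a v • a := by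
  rw [h.refl_def a ha, prL_apply]; congr 2; ring

lemma s_app {a : V} (ha : a ∈ Delo α s) (v : V) : s a v = v - prL B a v • a :=
  h.s_gen (h.Bne ha) v

lemma prL_self {a : V} (ha : B a a ≠ 0) : prL B a a = 2 := by
  rw [prL_apply]; field_simp

lemma s_self {a : V} (ha : B a a ≠ 0) : s a a = -a := by
  rw [h.s_gen ha, h.prL_self ha]; module

lemma B_s {a : V} (ha : B a a ≠ 0) (u v : V) : B (s a u) (s a v) = B u v := by
  rw [h.s_gen ha, h.s_gen ha, prL_apply, prL_apply]
  simp only [map_sub, map_smul, LinearMap.sub_apply, LinearMap.smul_apply, smul_eq_mul]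
  rw [h.Bsymm a v]
  field_simp
  ring

lemma s_sq {a : V} (ha : B a a ≠ 0) : s a * s a = 1 := by
  ext v
  change s a (s a v) = v
  rw [h.s_gen ha v, map_sub, map_smul, h.s_self ha, h.s_gen ha v]
  module

lemma s_inv {a : V} (ha : B a a ≠ 0) : (s a)⁻¹ = s a :=
  inv_eq_of_mul_eq_one_left (h.s_sq ha)

lemma conj {g : V ≃ₗ[ℝ] V} (hg : ∀ u v, B (g u) (g v) = B u v) {a : V} (ha : B a a ≠ 0) :
    s (g a) = g * s a * g⁻¹ := by
  ext v
  change s (g a) v = g (s a (g.symm v))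
  have ha' : B (g a) (g a) ≠ 0 := by rwa [hg]
  rw [h.s_gen ha', h.s_gen ha, map_sub, map_smul, prL_apply, prL_apply, hg]
  have := hg (g.symm v) a
  simp only [LinearEquiv.apply_symm_apply] at this ⊢
  rw [this]

lemma B_wo {g : V ≃ₗ[ℝ] V} (hg : g ∈ WoJ α s Set.univ) : ∀ u v, B (g u) (g v) = B u v := by
  induction hg using Subgroup.closure_induction with
  | mem x hx =>
    obtain ⟨j, -, rfl⟩ := hx
    exact h.B_s (h.Bne (alpha_mem j))
  | one => intro u v; rfl
  | mul x y _ _ hx hy =>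
    intro u v
    change B (x (y u)) (x (y v)) = _
    rw [hx, hy]
  | inv x _ hx =>
    intro u v
    have := hx (x.symm u) (x.symm v)
    simp only [LinearEquiv.apply_symm_apply] at this
    exact this.symm

lemma s_memJ {J : Set ι} {a : V} (ha : a ∈ DeloJ α s J) : s a ∈ WoJ α s J := by
  obtain ⟨g, hg, j, hj, rfl⟩ := ha
  rw [h.conj (h.B_wo (wo_univ hg)) (h.Bne (alpha_mem j))]
  exact mul_mem (mul_mem hg (gen_mem hj)) (inv_mem hg)

lemma s_root {J : Set ι} {a b : V} (ha : a ∈ DeloJ α s J) (hb : b ∈ DeloJ α s J) :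
    s a b ∈ DeloJ α s J := DeloJ_act (h.s_memJ ha) hb

lemma neg_memJ {J : Set ι} {a : V} (ha : a ∈ DeloJ α s J) : -a ∈ DeloJ α s J := by
  have := h.s_root ha ha
  rwa [h.s_self (h.Bne (DeloJ_sub ha))] at this

lemma neg_memJ_iff {J : Set ι} {a : V} : -a ∈ DeloJ α s J ↔ a ∈ DeloJ α s J :=
  ⟨fun ha => by simpa using h.neg_memJ ha, h.neg_memJ⟩

lemma ne_zero {a : V} (ha : a ∈ Delo α s) : a ≠ 0 := by
  rintro rfl
  exact h.Bne ha (by simp)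

lemma prL_inv {g : V ≃ₗ[ℝ] V} (hg : ∀ u v, B (g u) (g v) = B u v) (a v : V) :
    prL B (g a) (g v) = prL B a v := by
  rw [prL_apply, prL_apply, hg, hg]

lemma prL_int {a b : V} (ha : a ∈ Delo α s) (hb : b ∈ Delo α s) : ∃ m : ℤ, prL B b a = m := by
  obtain ⟨g, hg, j, -, rfl⟩ := hb
  obtain ⟨m, hm⟩ := h.cryst j (g⁻¹ a) (DeloJ_act (inv_mem hg) ha)
  refine ⟨m, ?_⟩
  have h1 := h.prL_inv (h.B_wo hg) (α j) (g⁻¹ a)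
  rw [show g (g⁻¹ a) = a from g.apply_symm_apply a] at h1
  rw [h1]
  rw [h.s_app (alpha_mem j), sub_right_inj, ← Int.cast_smul_eq_zsmul ℝ] at hm
  exact smul_left_injective ℝ (h.ne_zero (alpha_mem (s := s) j)) hm

/-- A positive semidefinite invariant form. -/
noncomputable def R (h : AffineSetup α δ θ B s) : V →ₗ[ℝ] V →ₗ[ℝ] ℝ :=
  ∑ ε ∈ h.finite.toFinset, (LinearMap.mul ℝ ℝ).compl₁₂ (prL B ε) (prL B ε)

lemma R_apply (u v : V) : h.R u v = ∑ ε ∈ h.finite.toFinset, prL B ε u * prL B ε v := by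
  simp [R, LinearMap.sum_apply]

lemma R_comm (u v : V) : h.R u v = h.R v u := by
  simp only [R_apply, mul_comm]

lemma R_nonneg (v : V) : 0 ≤ h.R v v := by
  rw [R_apply]; exact Finset.sum_nonneg fun i _ => mul_self_nonneg _

lemma R_pos {a : V} (ha : a ∈ Delo α s) : 0 < h.R a a := by
  rw [R_apply]
  refine Finset.sum_pos' (fun i _ => mul_self_nonneg _) ⟨a, by simpa using ha, ?_⟩
  rw [h.prL_self (h.Bne ha)]; norm_num

lemma R_s {a : V} (ha : a ∈ Delo α s) (u v : V) : h.R (s a u) (s a v) = h.R u v := by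
  rw [R_apply, R_apply]
  have hs : ∀ x, s a (s a x) = x := fun x =>
    congrArg (fun g : V ≃ₗ[ℝ] V => g x) (h.s_sq (h.Bne ha))
  refine Finset.sum_nbij' (fun x => s a x) (fun x => s a x) ?_ ?_ ?_ ?_ ?_
  · intro x hx; simp at hx ⊢; exact h.s_root ha hx
  · intro x hx; simp at hx ⊢; exact h.s_root ha hx
  · intro x _; exact hs x
  · intro x _; exact hs x
  · intro x _
    have e : ∀ w, prL B (s a x) w = prL B x (s a w) := fun w => by
      rw [← h.prL_inv (h.B_s (h.Bne ha)) x (s a w), hs]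
    simp only [e]

lemma R_pr {a : V} (ha : a ∈ Delo α s) (v : V) : 2 * h.R v a = prL B a v * h.R a a := by
  have h1 := h.R_s ha v a
  rw [h.s_self (h.Bne ha), h.s_app ha] at h1
  simp only [map_sub, map_smul, map_neg, LinearMap.sub_apply, LinearMap.smul_apply,
    smul_eq_mul] at h1
  linarith

lemma pr_neg_of_R {a v : V} (ha : a ∈ Delo α s) (hv : h.R v a < 0) : prL B a v < 0 := by
  have := h.R_pr ha v
  have := h.R_pos ha
  by_contra hc
  push Not at hc
  nlinarith

lemma R_neg_of_pr {a v : V} (ha : a ∈ Delo α s) (hv : prL B a v < 0) : h.R v a < 0 := by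
  have := h.R_pr ha v
  have := h.R_pos ha
  nlinarith

lemma R_pos_of_pr {a v : V} (ha : a ∈ Delo α s) (hv : 0 < prL B a v) : 0 < h.R v a := by
  have := h.R_pr ha v
  have := h.R_pos ha
  nlinarith

lemma pr_nonneg_of_R {a v : V} (ha : a ∈ Delo α s) (hv : 0 ≤ h.R v a) : 0 ≤ prL B a v := by
  have := h.R_pr ha v
  have := h.R_pos ha
  by_contra hc
  push Not at hc
  nlinarith

lemma R_rad {v : V} (hv : h.R v v = 0) {ε : V} (he : ε ∈ Delo α s) : prL B ε v = 0 := by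
  rw [R_apply, Finset.sum_eq_zero_iff_of_nonneg (fun i _ => mul_self_nonneg _)] at hv
  simpa using hv ε (by simpa using he)

lemma add_root {J : Set ι} {a b : V} (ha : a ∈ DeloJ α s J) (hb : b ∈ DeloJ α s J)
    (hR : h.R a b < 0) (hne : a + b ≠ 0) : a + b ∈ DeloJ α s J := by
  have ha' := DeloJ_sub ha
  have hb' := DeloJ_sub hb
  obtain ⟨p, hp⟩ := h.prL_int ha' hb'
  obtain ⟨q, hq⟩ := h.prL_int hb' ha'
  have hR' : h.R b a < 0 := by rwa [h.R_comm]
  have p0 : p < 0 := by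
    have := h.pr_neg_of_R hb' hR; rw [hp] at this; exact_mod_cast this
  have q0 : q < 0 := by
    have := h.pr_neg_of_R ha' hR'; rw [hq] at this; exact_mod_cast this
  by_cases hp1 : p = -1
  · have := h.s_root hb ha
    rw [h.s_app hb', hp, hp1] at this
    simpa using this
  by_cases hq1 : q = -1
  · have := h.s_root ha hb
    rw [h.s_app ha', hq, hq1] at this
    rw [add_comm]
    simpa using this
  exfalso
  have p2 : (p : ℝ) ≤ -2 := by exact_mod_cast (by omega : p ≤ -2)
  have q2 : (q : ℝ) ≤ -2 := by exact_mod_cast (by omega : q ≤ -2)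
  have e1 := h.R_pr hb' a
  have e2 := h.R_pr ha' b
  rw [hp] at e1
  rw [hq] at e2
  have n := h.R_nonneg (a + b)
  simp only [map_add, LinearMap.add_apply] at n
  have c := h.R_comm a b
  have pa := h.R_pos ha'
  have pb := h.R_pos hb'
  have z : h.R (a + b) (a + b) = 0 := by
    simp only [map_add, LinearMap.add_apply]
    nlinarith
  have hsv : ∀ c ∈ Delo α s, s c (a + b) = a + b := fun c hc => by
    rw [h.s_app hc, h.R_rad z hc]; simp
  have pa2 : prL B a b = -2 := by
    have := h.R_rad z ha'
    rw [map_add, h.prL_self (h.Bne ha')] at this; linarith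
  have pb2 : prL B b a = -2 := by
    have := h.R_rad z hb'
    rw [map_add, h.prL_self (h.Bne hb')] at this; linarith
  have key : ∀ n : ℕ, b + (2 * n : ℝ) • (a + b) ∈ Delo α s := by
    intro n
    induction n with
    | zero => simpa using hb'
    | succ n ih =>
      have := h.s_root hb' (h.s_root ha' ih)
      rw [map_add, map_smul, hsv a ha', map_add, map_smul, hsv b hb', h.s_app ha' b, pa2, map_sub,
        map_smul, h.s_app hb' a, h.s_self (h.Bne hb'), pb2] at this
      have e : b + (2 * ((n + 1 : ℕ) : ℝ)) • (a + b) =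
          -b - (-2 : ℝ) • (a - (-2 : ℝ) • b) + (2 * (n : ℝ)) • (a + b) := by
        push_cast
        module
      rw [e]
      exact this
  refine Set.infinite_of_injective_forall_mem (f := fun n : ℕ => b + (2 * n : ℝ) • (a + b)) ?_ key
    h.finite
  intro m n hmn
  simp only [add_right_inj] at hmn
  have := smul_left_injective ℝ hne hmn
  simpa using this

lemma sub_root {J : Set ι} {a b : V} (ha : a ∈ DeloJ α s J) (hb : b ∈ DeloJ α s J)
    (hR : 0 < h.R a b) (hne : a ≠ b) : a - b ∈ DeloJ α s J := by
  rw [sub_eq_add_neg]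
  refine h.add_root ha (h.neg_memJ hb) (by simpa using hR) ?_
  rwa [← sub_eq_add_neg, sub_ne_zero]

/-- three roots lemma -/
lemma three {J : Set ι} {a b c : V} (ha : a ∈ DeloJ α s J) (hb : b ∈ DeloJ α s J)
    (hc : c ∈ DeloJ α s J) (hbc : b + c ∈ DeloJ α s J) (habc : a + (b + c) ∈ DeloJ α s J)
    (hab : a + b ≠ 0) (hac : a + c ≠ 0) : a + b ∈ DeloJ α s J ∨ a + c ∈ DeloJ α s J := by
  by_cases h1 : 0 < h.R (a + (b + c)) b
  · right
    have := h.sub_root habc hb h1 (fun e => hac (by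
      have : a + (b + c) - b = 0 := sub_eq_zero.2 e
      rw [← this]; abel))
    convert this using 1; abel
  by_cases h2 : 0 < h.R (a + (b + c)) c
  · left
    have := h.sub_root habc hc h2 (fun e => hab (by
      have : a + (b + c) - c = 0 := sub_eq_zero.2 e
      rw [← this]; abel))
    convert this using 1; abel
  have h3 := h.R_pos (DeloJ_sub hbc)
  have h4 : h.R a b + h.R a c < 0 := by
    simp only [map_add, LinearMap.add_apply] at h1 h2 h3 ⊢
    linarith
  by_cases h5 : h.R a b < 0
  · exact Or.inl (h.add_root ha hb h5 hab)
  · exact Or.inr (h.add_root ha hc (by linarith) hac)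

end AffineSetup
end basics
end

section
set_option linter.unusedSectionVars false
variable {ι V : Type*} [Fintype ι] [Nonempty ι] [AddCommGroup V] [Module ℝ V]

section coords
variable {α : ι → V} {δ θ : V} {B : V →ₗ[ℝ] V →ₗ[ℝ] ℝ} {s : V → V ≃ₗ[ℝ] V}

namespace AffineSetup
variable (h : AffineSetup α δ θ B s)
include h

lemma wo_span {J : Set ι} {g : V ≃ₗ[ℝ] V} (hg : g ∈ WoJ α s J) :
    ∀ v, g v - v ∈ Submodule.span ℝ (α '' J) := by
  induction hg using Subgroup.closure_induction with
  | mem x hx =>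
    obtain ⟨j, hj, rfl⟩ := hx
    intro v
    change s (α j) v - v ∈ _
    rw [h.s_app (alpha_mem j)]
    have : v - prL B (α j) v • α j - v = (-prL B (α j) v) • α j := by module
    rw [this]
    exact Submodule.smul_mem _ _ (Submodule.subset_span ⟨j, hj, rfl⟩)
  | one => intro v; simp
  | mul x y _ _ hx hy =>
    intro v
    have := add_mem (hx (y v)) (hy v)
    rwa [sub_add_sub_cancel] at this
  | inv x _ hx =>
    intro v
    have := neg_mem (hx (x.symm v))
    simp only [LinearEquiv.apply_symm_apply, neg_sub] at this
    exact this

lemma root_span {J : Set ι} {a : V} (ha : a ∈ DeloJ α s J) : a ∈ Submodule.span ℝ (α '' J) := by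
  obtain ⟨g, hg, j, hj, rfl⟩ := ha
  have := add_mem (h.wo_span hg (α j)) (Submodule.subset_span ⟨j, hj, rfl⟩)
  rwa [sub_add_cancel] at this

lemma root_span' {a : V} (ha : a ∈ Delo α s) : a ∈ Submodule.span ℝ (Set.range α) := by
  simpa using h.root_span ha

lemma exists_co : ∃ (d : V →ₗ[ℝ] ℝ) (co : ι → V →ₗ[ℝ] ℝ), d δ = 1 ∧ (∀ i, d (α i) = 0) ∧
    (∀ i, co i δ = 0) ∧ (∀ i, co i (α i) = 1) ∧ ∀ i j, i ≠ j → co i (α j) = 0 := by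
  classical
  obtain ⟨f, hf⟩ := LinearMap.exists_extend (h.indep.repr : _ →ₗ[ℝ] (Option ι →₀ ℝ))
  have hf' : ∀ o, f (alHat α δ θ o) = Finsupp.single o 1 := by
    intro o
    have hm : alHat α δ θ o ∈ Submodule.span ℝ (Set.range (alHat α δ θ)) :=
      Submodule.subset_span ⟨o, rfl⟩
    have := congrArg (fun g => g ⟨_, hm⟩) hf
    simp only [LinearMap.comp_apply, Submodule.subtype_apply] at this
    rw [this]
    exact h.indep.repr_eq_single o _ rfl
  let H : Option ι → V →ₗ[ℝ] ℝ := fun o => (Finsupp.lapply o).comp f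
  have H1 : ∀ o, H o (alHat α δ θ o) = 1 := fun o => by simp [H, hf']
  have H2 : ∀ o p, o ≠ p → H o (alHat α δ θ p) = 0 := fun o p hop => by
    simp [H, hf', hop.symm]
  have hθ : H none θ = 0 := by
    have hs := h.root_span' h.theta_high.1
    have : Submodule.span ℝ (Set.range α) ≤ LinearMap.ker (H none) := by
      rw [Submodule.span_le]
      rintro _ ⟨i, rfl⟩
      exact H2 none (some i) (by simp)
    exact this hs
  have hd : H none δ = 1 := by
    have := H1 none
    simp only [alHat, Option.elim, map_sub, hθ, sub_zero] at this
    exact this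
  have hα : ∀ i, H none (α i) = 0 := fun i => H2 none (some i) (by simp)
  refine ⟨H none, fun i => H (some i) - H (some i) δ • H none, hd, hα, ?_, ?_, ?_⟩
  · intro i; simp [hd]
  · intro i
    have := H1 (some i)
    simp only [alHat, Option.elim] at this
    simp [hα, this]
  · intro i j hij
    have := H2 (some i) (some j) (by simpa using hij)
    simp only [alHat, Option.elim] at this
    simp [hα, this]

/-- coordinate along `δ` -/
noncomputable def dd (h : AffineSetup α δ θ B s) : V →ₗ[ℝ] ℝ := h.exists_co.choose
/-- coordinate along `α i` -/
noncomputable def co (h : AffineSetup α δ θ B s) : ι → V →ₗ[ℝ] ℝ := h.exists_co.choose_spec.choose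

lemma dd_delta : h.dd δ = 1 := h.exists_co.choose_spec.choose_spec.1
lemma dd_alpha (i : ι) : h.dd (α i) = 0 := h.exists_co.choose_spec.choose_spec.2.1 i
lemma co_delta (i : ι) : h.co i δ = 0 := h.exists_co.choose_spec.choose_spec.2.2.1 i
lemma co_self (i : ι) : h.co i (α i) = 1 := h.exists_co.choose_spec.choose_spec.2.2.2.1 i
lemma co_ne {i j : ι} (hij : i ≠ j) : h.co i (α j) = 0 :=
  h.exists_co.choose_spec.choose_spec.2.2.2.2 i j hij

lemma co_sum (c : ι → ℝ) (i : ι) : h.co i (∑ j, c j • α j) = c i := by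
  classical
  rw [map_sum, Finset.sum_eq_single i]
  · simp [h.co_self]
  · intro j _ hj; simp [h.co_ne hj.symm]
  · simp

lemma dd_sum (c : ι → ℝ) : h.dd (∑ j, c j • α j) = 0 := by
  simp [map_sum, h.dd_alpha]

lemma expand_span {v : V} (hv : v ∈ Submodule.span ℝ (Set.range α)) : v = ∑ i, h.co i v • α i := by
  obtain ⟨c, rfl⟩ := (Submodule.mem_span_range_iff_exists_fun ℝ).1 hv
  simp [h.co_sum]

lemma expand {a : V} (ha : a ∈ Delo α s) : a = ∑ i, h.co i a • α i :=
  h.expand_span (h.root_span' ha)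

lemma dd_root {a : V} (ha : a ∈ Delo α s) : h.dd a = 0 := by
  rw [h.expand ha, h.dd_sum]

lemma co_out {J : Set ι} {a : V} (ha : a ∈ DeloJ α s J) {i : ι} (hi : i ∉ J) : h.co i a = 0 := by
  have : Submodule.span ℝ (α '' J) ≤ LinearMap.ker (h.co i) := by
    rw [Submodule.span_le]
    rintro _ ⟨j, hj, rfl⟩
    exact h.co_ne (by rintro rfl; exact hi hj)
  exact this (h.root_span ha)

lemma pos_iff {a : V} (ha : a ∈ Delo α s) : PosoComb α a ↔ ∀ i, 0 ≤ h.co i a := by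
  constructor
  · rintro ⟨c, hc, rfl⟩ i
    rw [h.co_sum]; exact hc i
  · intro hc
    exact ⟨_, hc, h.expand ha⟩

lemma neg_iff {a : V} (ha : a ∈ Delo α s) : PosoComb α (-a) ↔ ∀ i, h.co i a ≤ 0 := by
  rw [h.pos_iff (show -a ∈ Delo α s from h.neg_memJ ha)]
  simp

lemma pos_alpha (i : ι) : PosoComb α (α i) := by
  classical
  rw [h.pos_iff (alpha_mem (s := s) i)]
  intro j
  by_cases hj : j = i
  · subst hj; rw [h.co_self]; norm_num
  · rw [h.co_ne hj]

lemma pos_or {a : V} (ha : a ∈ Delo α s) : PosoComb α a ∨ PosoComb α (-a) := by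
  rcases h.base a ha with ⟨h1, -⟩ | ⟨h1, -⟩
  · exact Or.inl h1
  · exact Or.inr h1

lemma not_both {a : V} (ha : a ∈ Delo α s) (h1 : PosoComb α a) (h2 : PosoComb α (-a)) : False := by
  rcases h.base a ha with ⟨-, h3⟩ | ⟨-, h3⟩
  · exact h3 h2
  · exact h3 h1

lemma not_pos {a : V} (ha : a ∈ Delo α s) : ¬ PosoComb α a ↔ PosoComb α (-a) :=
  ⟨fun hh => (h.pos_or ha).resolve_left hh, fun h2 h1 => h.not_both ha h1 h2⟩

lemma pos_of_co {a : V} (ha : a ∈ Delo α s) {i : ι} (hi : 0 < h.co i a) : PosoComb α a := by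
  by_contra hn
  rw [h.not_pos ha, h.neg_iff ha] at hn
  exact absurd (hn i) (not_le.2 hi)

lemma pos_add {a b : V} (ha : PosoComb α a) (hb : PosoComb α b) : PosoComb α (a + b) := by
  obtain ⟨c, hc, rfl⟩ := ha
  obtain ⟨c', hc', rfl⟩ := hb
  exact ⟨fun i => c i + c' i, fun i => add_nonneg (hc i) (hc' i), by
    simp [add_smul, Finset.sum_add_distrib]⟩

lemma co_int {a : V} (ha : a ∈ Delo α s) (i : ι) : ∃ m : ℤ, h.co i a = m := by
  obtain ⟨g, hg, j, -, rfl⟩ := ha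
  induction hg using Subgroup.closure_induction_left with
  | one =>
    by_cases hij : i = j
    · subst hij; exact ⟨1, by simpa using h.co_self i⟩
    · exact ⟨0, by simpa using h.co_ne hij⟩
  | mul_left x hx y hy ih =>
    obtain ⟨k, -, rfl⟩ := hx
    obtain ⟨m, hm⟩ := ih
    obtain ⟨n, hn⟩ := h.prL_int (show y (α j) ∈ Delo α s from ⟨y, hy, j, trivial, rfl⟩)
      (alpha_mem (s := s) k)
    change ∃ m : ℤ, h.co i (s (α k) (y (α j))) = m
    rw [h.s_app (alpha_mem k), map_sub, map_smul, hm, hn]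
    by_cases hik : i = k
    · subst hik; exact ⟨m - n, by simp [h.co_self]⟩
    · exact ⟨m, by simp [h.co_ne hik]⟩
  | inv_mul_cancel x hx y hy ih =>
    obtain ⟨k, -, rfl⟩ := hx
    obtain ⟨m, hm⟩ := ih
    obtain ⟨n, hn⟩ := h.prL_int (show y (α j) ∈ Delo α s from ⟨y, hy, j, trivial, rfl⟩)
      (alpha_mem (s := s) k)
    change ∃ m : ℤ, h.co i ((s (α k))⁻¹ (y (α j))) = m
    rw [h.s_inv (h.Bne (alpha_mem k)), h.s_app (alpha_mem k), map_sub, map_smul, hm, hn]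
    by_cases hik : i = k
    · subst hik; exact ⟨m - n, by simp [h.co_self]⟩
    · exact ⟨m, by simp [h.co_ne hik]⟩

lemma co_ge_one {a : V} (ha : a ∈ Delo α s) {i : ι} (hi : 0 < h.co i a) : 1 ≤ h.co i a := by
  obtain ⟨m, hm⟩ := h.co_int ha i
  rw [hm] at hi ⊢
  have : 0 < m := by exact_mod_cast hi
  exact_mod_cast this

/-- height -/
noncomputable def ht (h : AffineSetup α δ θ B s) : V →ₗ[ℝ] ℝ := ∑ i, h.co i

lemma ht_apply (v : V) : h.ht v = ∑ i, h.co i v := by simp [ht]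

lemma ht_alpha (i : ι) : h.ht (α i) = 1 := by
  classical
  rw [ht_apply, Finset.sum_eq_single i, h.co_self]
  · intro j _ hj; exact h.co_ne hj
  · simp

lemma ht_int {a : V} (ha : a ∈ Delo α s) : ∃ m : ℤ, h.ht a = m := by
  choose m hm using h.co_int ha
  exact ⟨∑ i, m i, by simp [ht_apply, hm]⟩

lemma ht_nat {a : V} (ha : a ∈ Delo α s) (hp : PosoComb α a) : ∃ n : ℕ, h.ht a = n := by
  obtain ⟨m, hm⟩ := h.ht_int ha
  have : 0 ≤ h.ht a := by
    rw [ht_apply]; exact Finset.sum_nonneg fun i _ => (h.pos_iff ha).1 hp i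
  rw [hm] at this
  lift m to ℕ using (by exact_mod_cast this)
  exact ⟨m, by simpa using hm⟩

lemma R_expand {a : V} (ha : a ∈ Delo α s) (v : V) :
    h.R v a = ∑ i, h.co i a * h.R v (α i) :=
  calc h.R v a = h.R v (∑ i, h.co i a • α i) := congrArg _ (h.expand ha)
    _ = _ := by rw [map_sum]; simp

/-- A positive root has a simple root in its support with positive pairing. -/
lemma exists_desc {J : Set ι} {a : V} (ha : a ∈ Delo α s) (hJ : ∀ i, i ∉ J → h.co i a = 0)
    (hp : PosoComb α a) : ∃ j ∈ J, 0 < h.co j a ∧ 0 < h.R a (α j) := by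
  by_contra hc
  push Not at hc
  have h1 := h.R_expand ha a
  have h2 : h.R a a ≤ 0 := by
    rw [h1]
    refine Finset.sum_nonpos fun i _ => ?_
    have hi := (h.pos_iff ha).1 hp i
    rcases hi.eq_or_lt with h0 | h0
    · rw [← h0]; simp
    · have hiJ : i ∈ J := by
        by_contra hn; rw [hJ i hn] at h0; exact lt_irrefl _ h0
      exact mul_nonpos_of_nonneg_of_nonpos hi (hc i hiJ h0)
  exact absurd (h.R_pos ha) (not_lt.2 h2)

lemma sub_alpha_pos {a : V} {j : ι} (ha : a ∈ Delo α s) (hp : PosoComb α a)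
    (hj : 0 < h.co j a) (hm : a - α j ∈ Delo α s) : PosoComb α (a - α j) := by
  rw [h.pos_iff hm]
  intro i
  rw [map_sub]
  by_cases hi : i = j
  · subst hi; rw [h.co_self]; have := h.co_ge_one ha hj; linarith
  · rw [h.co_ne hi]; simpa using (h.pos_iff ha).1 hp i

lemma prop_alpha {a : V} {j : ι} (ha : a ∈ Delo α s) (hp : PosoComb α a)
    (hj : ∀ i, i ≠ j → h.co i a = 0) : a = α j := by
  have e : a = h.co j a • α j := by
    conv_lhs => rw [h.expand ha]
    rw [Finset.sum_eq_single j]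
    · intro i _ hi; rw [hj i hi, zero_smul]
    · simp
  obtain ⟨k, hk⟩ := h.co_int ha j
  obtain ⟨g, hg, l, -, hgl⟩ := id ha
  have hroot : g⁻¹ (α j) ∈ Delo α s := DeloJ_act (inv_mem hg) (alpha_mem j)
  obtain ⟨m, hm⟩ := h.co_int hroot l
  have e2 : α l = (k : ℝ) • g⁻¹ (α j) := by
    rw [← map_smul, ← hk, ← e, hgl]
    exact (g.symm_apply_apply _).symm
  have e3 := congrArg (h.co l) e2
  rw [h.co_self, map_smul, hm, smul_eq_mul] at e3
  have e4 : k * m = 1 := by exact_mod_cast e3.symm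
  have k0 : 0 ≤ k := by
    have := (h.pos_iff ha).1 hp j
    rw [hk] at this; exact_mod_cast this
  have k1 : k = 1 := by
    rcases Int.eq_one_or_neg_one_of_mul_eq_one e4 with h1 | h1 <;> omega
  rw [e, hk, k1]; simp

lemma s_pos {a : V} {j : ι} (ha : a ∈ Delo α s) (hp : PosoComb α a) (hne : a ≠ α j) :
    PosoComb α (s (α j) a) := by
  have hr : s (α j) a ∈ Delo α s := h.s_root (alpha_mem j) ha
  by_contra hn
  rw [h.not_pos hr, h.neg_iff hr] at hn
  apply hne
  apply h.prop_alpha ha hp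
  intro i hi
  have h1 := hn i
  rw [h.s_app (alpha_mem j), map_sub, map_smul, h.co_ne hi] at h1
  simp at h1
  exact le_antisymm h1 ((h.pos_iff ha).1 hp i)

/-- roots of `∘Δ` supported in `K` belong to `∘Δ_K`. -/
lemma memJ_iff {K : Set ι} {a : V} :
    a ∈ DeloJ α s K ↔ a ∈ Delo α s ∧ ∀ i, i ∉ K → h.co i a = 0 := by
  refine ⟨fun ha => ⟨DeloJ_sub ha, fun i hi => h.co_out ha hi⟩, ?_⟩
  have key : ∀ n : ℕ, ∀ a, a ∈ Delo α s → PosoComb α a → (∀ i, i ∉ K → h.co i a = 0) →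
      h.ht a = n → a ∈ DeloJ α s K := by
    intro n
    induction n using Nat.strong_induction_on with
    | _ n ih =>
      intro a ha hp hK hn
      obtain ⟨j, hjK, hj, hR⟩ := h.exists_desc ha hK hp
      by_cases haj : a = α j
      · rw [haj]; exact alpha_memJ hjK
      have hr : s (α j) a ∈ Delo α s := h.s_root (alpha_mem j) ha
      have hp' := h.s_pos ha hp haj
      obtain ⟨m, hm⟩ := h.ht_nat hr hp'
      have hpr : 0 < prL B (α j) a := by
        have := h.R_pr (alpha_mem (s := s) j) a
        have := h.R_pos (alpha_mem (s := s) j)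
        by_contra hc
        push Not at hc
        nlinarith
      have e := h.s_app (alpha_mem (s := s) j) a
      have hlt : m < n := by
        have := congrArg h.ht e
        rw [hm, map_sub, map_smul, hn, h.ht_alpha, smul_eq_mul, mul_one] at this
        have : (m : ℝ) < n := by linarith
        exact_mod_cast this
      have := ih m hlt _ hr hp' (fun i hi => by
        rw [e, map_sub, map_smul, hK i hi, h.co_ne (by rintro rfl; exact hi hjK)]; simp) hm
      exact (DeloJ_act_iff (gen_mem hjK)).1 this
  rintro ⟨ha, hK⟩
  rcases h.pos_or ha with hp | hp
  · obtain ⟨n, hn⟩ := h.ht_nat ha hp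
    exact key n a ha hp hK hn
  · have ha' : -a ∈ Delo α s := h.neg_memJ ha
    obtain ⟨n, hn⟩ := h.ht_nat ha' hp
    exact h.neg_memJ_iff.1 (key n _ ha' hp (fun i hi => by simp [hK i hi]) hn)

/-- closedness of `∘Δ_K`. -/
lemma memJ_add {K : Set ι} {a b : V} (ha : a ∈ DeloJ α s K) (hb : b ∈ DeloJ α s K)
    (hab : a + b ∈ Delo α s) : a + b ∈ DeloJ α s K := by
  rw [h.memJ_iff]
  exact ⟨hab, fun i hi => by rw [map_add, h.co_out ha hi, h.co_out hb hi, add_zero]⟩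

lemma alpha_memJ_iff {K : Set ι} {j : ι} : α j ∈ DeloJ α s K ↔ j ∈ K := by
  refine ⟨fun hj => ?_, alpha_memJ⟩
  by_contra hn
  have := h.co_out hj hn
  rw [h.co_self] at this
  exact one_ne_zero this

/-- induction over positive roots of `∘Δ_K` -/
lemma pos_induct {K : Set ι} {Q : V → Prop} (h1 : ∀ k ∈ K, Q (α k))
    (h2 : ∀ a ∈ DeloJ α s K, PosoComb α a → ∀ k ∈ K, a + α k ∈ DeloJ α s K → Q a → Q (a + α k)) :
    ∀ a ∈ DeloJ α s K, PosoComb α a → Q a := by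
  have key : ∀ n : ℕ, ∀ a, a ∈ DeloJ α s K → PosoComb α a → h.ht a = n → Q a := by
    intro n
    induction n with
    | zero =>
      intro a ha hp hn
      exfalso
      obtain ⟨j, hjK, hj, hR⟩ := h.exists_desc (J := K) (DeloJ_sub ha) (fun i => h.co_out ha) hp
      rw [ht_apply] at hn
      have : h.co j a ≤ ∑ i, h.co i a := Finset.single_le_sum
        (f := fun i => h.co i a) (fun i _ => (h.pos_iff (DeloJ_sub ha)).1 hp i) (Finset.mem_univ j)
      simp at hn
      linarith
    | succ n ih =>
      intro a ha hp hn
      obtain ⟨j, hjK, hj, hR⟩ := h.exists_desc (J := K) (DeloJ_sub ha) (fun i => h.co_out ha) hp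
      by_cases haj : a = α j
      · rw [haj]; exact h1 j hjK
      have hm := h.sub_root ha (alpha_memJ hjK) hR haj
      have hp' := h.sub_alpha_pos (DeloJ_sub ha) hp hj (DeloJ_sub hm)
      have := h2 _ hm hp' j hjK (by simpa using ha) (ih _ hm hp' (by
        rw [map_sub, hn, h.ht_alpha]; push_cast; ring))
      simpa using this
  intro a ha hp
  obtain ⟨n, hn⟩ := h.ht_nat (DeloJ_sub ha) hp
  exact key n a ha hp hn

end AffineSetup
end coords
end

section
set_option linter.unusedSectionVars false
variable {ι V : Type*} [Fintype ι] [Nonempty ι] [AddCommGroup V] [Module ℝ V]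

/-- positivity of the real root `mδ + ε` -/
def posR (α : ι → V) (m : ℤ) (ε : V) : Prop := 0 < m ∨ (m = 0 ∧ PosoComb α ε)

section affine
variable {α : ι → V} {δ θ : V} {B : V →ₗ[ℝ] V →ₗ[ℝ] ℝ} {s : V → V ≃ₗ[ℝ] V}

namespace AffineSetup
variable (h : AffineSetup α δ θ B s)
include h

lemma pos_add_ne {a b : V} (ha : a ∈ Delo α s) (hp : PosoComb α a) (hq : PosoComb α b) :
    a + b ≠ 0 := by
  intro e
  rw [eq_neg_of_add_eq_zero_right e] at hq
  exact h.not_both ha hp hq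

lemma hi_not {K : Set ι} {x : V} (hx : x ∈ HighRoots α s K) :
    ∀ γ ∈ DeloJ α s K, PosoComb α γ → x + γ ∉ DeloJ α s K := by
  obtain ⟨hxK, hxp, hxj⟩ := hx
  refine h.pos_induct hxj ?_
  intro a ha hp k hk hak hQ hc
  rcases h.three hxK ha (alpha_memJ hk) hak hc (h.pos_add_ne (DeloJ_sub hxK) hxp hp)
    (h.pos_add_ne (DeloJ_sub hxK) hxp (h.pos_alpha k)) with h1 | h1
  · exact hQ h1
  · exact hxj k hk h1

lemma hi_R {K : Set ι} {x : V} (hx : x ∈ HighRoots α s K) {γ : V} (hγ : γ ∈ DeloJ α s K)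
    (hp : PosoComb α γ) : 0 ≤ h.R γ x := by
  by_contra hc
  push Not at hc
  rw [h.R_comm] at hc
  exact h.hi_not hx γ hγ hp (h.add_root hx.1 hγ hc (h.pos_add_ne (DeloJ_sub hx.1) hx.2.1 hp))

lemma hi_pr {K : Set ι} {x : V} (hx : x ∈ HighRoots α s K) {γ : V} (hγ : γ ∈ DeloJ α s K)
    (hp : PosoComb α γ) : 0 ≤ prL B x γ :=
  h.pr_nonneg_of_R (DeloJ_sub hx.1) (h.hi_R hx hγ hp)

lemma hi_le {K : Set ι} {x : V} (hx : x ∈ HighRoots α s K) {ε : V} (hε : ε ∈ DeloJ α s K)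
    (hne : ε ≠ x) : prL B x ε ≤ 1 := by
  by_contra hc
  push Not at hc
  obtain ⟨k, hk⟩ := h.prL_int (DeloJ_sub hε) (DeloJ_sub hx.1)
  have hR := h.R_pos_of_pr (DeloJ_sub hx.1) (by linarith : 0 < prL B x ε)
  have hm := h.sub_root hε hx.1 hR hne
  rcases h.pos_or (DeloJ_sub hm) with hp | hp
  · exact h.hi_not hx _ hm hp (by simpa using hε)
  · have hm' := h.neg_memJ hm
    rw [neg_sub] at hp hm'
    have h1 := h.hi_pr hx hm' hp
    rw [map_sub, h.prL_self (h.Bne (DeloJ_sub hx.1)), hk] at h1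
    rw [hk] at hc
    have h2 : k ≤ 2 := by
      have : (k : ℝ) ≤ 2 := by linarith
      exact_mod_cast this
    have h3 : 1 < k := by exact_mod_cast hc
    have h4 : k = 2 := by omega
    have := h.neg_memJ (h.s_root hx.1 hε)
    rw [h.s_app (DeloJ_sub hx.1), hk, h4] at this
    apply h.hi_not hx _ hm' hp
    convert this using 1
    push_cast
    module

lemma theta_co_pos (i : ι) : 0 < h.co i θ := by
  have hθ := h.theta_high
  have hp := (h.pos_iff hθ.1).1 hθ.2.1
  have hirr := h.irred {i | h.co i θ ≠ 0} (by
    intro i hi j hj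
    simp only [Set.mem_ofPred_eq, Set.mem_compl_iff, not_not] at hi hj
    have hne : i ≠ j := by rintro rfl; exact hi hj
    have hle : ∀ k, k ≠ j → h.R (α j) (α k) ≤ 0 := by
      intro k hk
      by_contra hc
      push Not at hc
      have hm := h.sub_root (alpha_mem (s := s) j) (alpha_mem k) hc (by
        intro e
        have := congrArg (h.co j) e
        rw [h.co_self, h.co_ne hk.symm] at this
        exact one_ne_zero this)
      have h1 := h.pos_of_co hm (i := j) (by simp [h.co_self, h.co_ne hk.symm])
      have h2 := (h.pos_iff hm).1 h1 k
      simp [h.co_self, h.co_ne hk] at h2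
      linarith
    have h0 := h.hi_R hθ (alpha_memJ (s := s) (Set.mem_univ j)) (h.pos_alpha j)
    rw [h.R_expand hθ.1] at h0
    have hterm : ∀ k ∈ Finset.univ, h.co k θ * h.R (α j) (α k) ≤ 0 := by
      intro k _
      by_cases hk : k = j
      · subst hk; rw [hj]; simp
      · exact mul_nonpos_of_nonneg_of_nonpos (hp k) (hle k hk)
    have hz := (Finset.sum_eq_zero_iff_of_nonpos hterm).1
      (le_antisymm (Finset.sum_nonpos hterm) h0) i (Finset.mem_univ i)
    have hR : h.R (α j) (α i) = 0 := by
      rcases mul_eq_zero.1 hz with h1 | h1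
      · exact absurd h1 hi
      · exact h1
    have hpr := h.R_pr (alpha_mem (s := s) i) (α j)
    rw [hR, mul_zero] at hpr
    rw [h.s_app (alpha_mem i), (mul_eq_zero.1 hpr.symm).resolve_right
      (h.R_pos (alpha_mem (s := s) i)).ne']
    simp)
  have hi : i ∈ {i | h.co i θ ≠ 0} := by
    rcases hirr with h1 | h1
    · exfalso
      apply h.ne_zero hθ.1
      rw [h.expand hθ.1]
      refine Finset.sum_eq_zero fun j _ => ?_
      have : j ∉ {i | h.co i θ ≠ 0} := by rw [h1]; simp
      simp only [Set.mem_ofPred_eq, not_not] at this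
      rw [this, zero_smul]
    · rw [h1]; trivial
  exact lt_of_le_of_ne (hp i) (Ne.symm hi)

lemma theta_ge {ε : V} (hε : ε ∈ Delo α s) : ∀ i, h.co i ε ≤ h.co i θ := by
  by_contra hc
  have hfin : {ε ∈ Delo α s | ¬ ∀ i, h.co i ε ≤ h.co i θ}.Finite := h.finite.subset (fun x hx => hx.1)
  obtain ⟨x, hx, hmax⟩ := hfin.exists_maximalFor (fun x => h.ht x) _ ⟨ε, hε, hc⟩
  obtain ⟨hxr, hxn⟩ := hx
  have hθ := h.theta_high
  have hxp : PosoComb α x := by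
    by_contra hp
    rw [h.not_pos hxr, h.neg_iff hxr] at hp
    exact hxn fun i => (hp i).trans (h.theta_co_pos i).le
  have hxh : x ∈ HighRoots α s Set.univ := by
    refine ⟨hxr, hxp, fun j _ hj => ?_⟩
    have : ¬ ∀ i, h.co i (x + α j) ≤ h.co i θ := by
      intro hle
      apply hxn
      intro i
      have h1 := hle i
      have h2 := (h.pos_iff (alpha_mem (s := s) j)).1 (h.pos_alpha j) i
      rw [map_add] at h1
      linarith
    have h3 := hmax ⟨hj, this⟩ (by simp [h.ht_alpha])
    simp [h.ht_alpha] at h3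
    linarith
  have hR : 0 < h.R θ x := by
    rw [h.R_comm, h.R_expand hθ.1]
    have hnn : ∀ i, 0 ≤ h.R x (α i) := fun i => by
      rw [h.R_comm]; exact h.hi_R hxh (alpha_mem i) (h.pos_alpha i)
    obtain ⟨j, -, -, hj⟩ := h.exists_desc (J := Set.univ) hxr (by simp) hxp
    exact Finset.sum_pos' (fun i _ => mul_nonneg (h.theta_co_pos i).le (hnn i))
      ⟨j, Finset.mem_univ j, mul_pos (h.theta_co_pos j) hj⟩
  by_cases e : θ = x
  · exact hxn fun i => (congrArg (h.co i) e.symm).le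
  have hm := h.sub_root hθ.1 hxr hR e
  rcases h.pos_or hm with hp | hp
  · rw [h.pos_iff hm] at hp
    refine hxn fun i => ?_
    have := hp i
    rw [map_sub] at this
    linarith
  · have hm' := h.neg_memJ hm
    refine h.hi_not hθ _ hm' hp ?_
    rw [neg_sub, add_sub_cancel]
    exact hxr

/-! ### positivity of affine roots -/

lemma dd_z (m : ℤ) : h.dd (m • δ) = m := by
  rw [map_zsmul, h.dd_delta]; simp

lemma co_z (m : ℤ) (i : ι) : h.co i (m • δ) = 0 := by
  rw [map_zsmul, h.co_delta]; simp

lemma PosComb_iff {v : V} (hv : v = h.dd v • δ + ∑ i, h.co i v • α i) :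
    PosComb α δ θ v ↔ 0 ≤ h.dd v ∧ ∀ i, 0 ≤ h.co i v + h.dd v * h.co i θ := by
  have hθ := h.expand h.theta_high.1
  constructor
  · rintro ⟨c, hc, e⟩
    rw [Fintype.sum_option] at e
    simp only [alHat, Option.elim] at e
    have e1 : h.dd v = c none := by
      rw [e, map_add, h.dd_sum, map_smul, map_sub, h.dd_delta, h.dd_root h.theta_high.1]; simp
    have e2 : ∀ i, h.co i v = -(c none * h.co i θ) + c (some i) := by
      intro i
      rw [e, map_add, h.co_sum, map_smul, map_sub, h.co_delta]; simp
    refine ⟨by rw [e1]; exact hc _, fun i => ?_⟩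
    rw [e1, e2]
    have := hc (some i)
    linarith
  · rintro ⟨h1, h2⟩
    refine ⟨fun o => o.elim (h.dd v) (fun i => h.co i v + h.dd v * h.co i θ), ?_, ?_⟩
    · rintro (_ | i)
      · exact h1
      · exact h2 i
    · rw [Fintype.sum_option]
      simp only [alHat, Option.elim, add_smul, Finset.sum_add_distrib, mul_smul]
      rw [← Finset.smul_sum, ← hθ]
      nth_rewrite 1 [hv]
      module

lemma PosComb_re {m : ℤ} {ε : V} (hε : ε ∈ Delo α s) :
    PosComb α δ θ (m • δ + ε) ↔ posR α m ε := by
  have e1 : h.dd (m • δ + ε) = m := by rw [map_add, h.dd_z, h.dd_root hε, add_zero]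
  have e2 : ∀ i, h.co i (m • δ + ε) = h.co i ε := fun i => by rw [map_add, h.co_z, zero_add]
  rw [h.PosComb_iff]
  · simp only [e1, e2]
    constructor
    · rintro ⟨h1, h2⟩
      have h3 : 0 ≤ m := by exact_mod_cast h1
      rcases h3.eq_or_lt with h4 | h4
      · right
        refine ⟨h4.symm, (h.pos_iff hε).2 fun i => ?_⟩
        have := h2 i
        rw [← h4] at this
        simpa using this
      · left; exact h4
    · rintro (h1 | ⟨h1, h2⟩)
      · have h3 : (1 : ℝ) ≤ m := by exact_mod_cast h1
        refine ⟨by linarith, fun i => ?_⟩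
        have h4 := h.theta_ge (h.neg_memJ hε) i
        have h5 := h.theta_co_pos i
        rw [map_neg] at h4
        nlinarith
      · subst h1
        refine ⟨by simp, fun i => ?_⟩
        simpa using (h.pos_iff hε).1 h2 i
  · simp only [e1, e2, ← h.expand hε, Int.cast_smul_eq_zsmul]

lemma PosComb_im {m : ℤ} : PosComb α δ θ (m • δ) ↔ 0 ≤ m := by
  rw [h.PosComb_iff]
  · simp only [h.dd_z, h.co_z, zero_add]
    constructor
    · rintro ⟨h1, -⟩; exact_mod_cast h1
    · intro h1
      have : (0 : ℝ) ≤ m := by exact_mod_cast h1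
      exact ⟨this, fun i => mul_nonneg this (h.theta_co_pos i).le⟩
  · simp [h.dd_z, h.co_z, Int.cast_smul_eq_zsmul]

lemma uniq {m n : ℤ} {a b : V} (ha : h.dd a = 0) (hb : h.dd b = 0)
    (e : m • δ + a = n • δ + b) : m = n ∧ a = b := by
  have h1 := congrArg h.dd e
  rw [map_add, map_add, ha, hb, h.dd_z, h.dd_z] at h1
  have h2 : m = n := by simpa using h1
  subst h2
  exact ⟨rfl, by simpa using e⟩

lemma uniq0 {m n : ℤ} {b : V} (hb : b ∈ Delo α s) : m • δ ≠ n • δ + b := by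
  intro e
  rw [← add_zero (m • δ)] at e
  exact h.ne_zero hb (h.uniq (by simp) (h.dd_root hb) e).2.symm

lemma mem_DelRe {m : ℤ} {ε : V} (hε : ε ∈ Delo α s) : m • δ + ε ∈ DelRe α δ s := ⟨m, ε, hε, rfl⟩

lemma mem_DelPos_re {m : ℤ} {ε : V} (hε : ε ∈ Delo α s) :
    m • δ + ε ∈ DelPos α δ θ s ↔ posR α m ε := by
  rw [← h.PosComb_re hε]
  exact ⟨fun hh => hh.2, fun hh => ⟨Or.inl (h.mem_DelRe hε), hh⟩⟩

lemma mem_DelPos_im {m : ℤ} : m • δ ∈ DelPos α δ θ s ↔ 0 < m := by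
  constructor
  · rintro ⟨h1, h2⟩
    rw [h.PosComb_im] at h2
    rcases h2.eq_or_lt with h3 | h3
    · subst h3
      exfalso
      rcases h1 with ⟨n, ε, hε, e⟩ | ⟨n, hn, e⟩
      · exact h.uniq0 hε e
      · have := congrArg h.dd e
        rw [h.dd_z, h.dd_z] at this
        exact hn (by exact_mod_cast this.symm)
    · exact h3
  · intro hm
    exact ⟨Or.inr ⟨m, hm.ne', rfl⟩, h.PosComb_im.2 hm.le⟩

lemma posR_neg {m : ℤ} {ε : V} (hε : ε ∈ Delo α s) : posR α (-m) (-ε) ↔ ¬ posR α m ε := by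
  unfold posR
  have h1 := h.not_pos hε
  have h2 := h.pos_or hε
  by_cases hp : PosoComb α ε
  · have : ¬ PosoComb α (-ε) := fun hh => h.not_both hε hp hh
    simp only [hp, this, and_true, and_false, or_false]; omega
  · have : PosoComb α (-ε) := h1.1 hp
    simp only [hp, this, and_true, and_false, or_false]; omega

lemma mem_DelNeg_re {m : ℤ} {ε : V} (hε : ε ∈ Delo α s) :
    m • δ + ε ∈ DelNeg α δ θ s ↔ ¬ posR α m ε := by
  rw [← h.posR_neg hε, ← h.mem_DelPos_re (show -ε ∈ Delo α s from h.neg_memJ hε)]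
  unfold DelNeg
  rw [Set.mem_ofPred_eq]
  have : -(m • δ + ε) = (-m) • δ + -ε := by rw [neg_add, neg_smul]
  rw [this]

lemma mem_DelNeg_im {m : ℤ} : m • δ ∈ DelNeg α δ θ s ↔ m < 0 := by
  unfold DelNeg
  rw [Set.mem_ofPred_eq, ← neg_smul, h.mem_DelPos_im]
  omega

lemma mem_brSet {P : Set V} (hP : P ⊆ Delo α s) {v : V} :
    v ∈ brSet α δ θ s P ↔ ∃ m : ℤ, ∃ ε ∈ P, posR α m ε ∧ v = m • δ + ε := by
  simp only [brSet, Set.mem_iUnion, brkt, Set.mem_inter_iff, Set.mem_ofPred_eq, exists_prop]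
  constructor
  · rintro ⟨ε, hε, ⟨m, rfl⟩, hv⟩
    exact ⟨m, ε, hε, (h.mem_DelPos_re (hP hε)).1 hv.2, rfl⟩
  · rintro ⟨m, ε, hε, hp, rfl⟩
    have hm : 0 ≤ m := by rcases hp with h1 | ⟨h1, -⟩ <;> omega
    lift m to ℕ using hm
    exact ⟨ε, hε, ⟨m, rfl⟩, h.mem_DelRe (hP hε), (h.mem_DelPos_re (hP hε)).2 hp⟩

lemma mem_brSet_re {P : Set V} (hP : P ⊆ Delo α s) {m : ℤ} {ε : V} (hε : ε ∈ Delo α s) :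
    m • δ + ε ∈ brSet α δ θ s P ↔ ε ∈ P ∧ posR α m ε := by
  rw [h.mem_brSet hP]
  constructor
  · rintro ⟨n, η, hη, hp, e⟩
    obtain ⟨rfl, rfl⟩ := h.uniq (h.dd_root hε) (h.dd_root (hP hη)) e
    exact ⟨hη, hp⟩
  · rintro ⟨h1, h2⟩
    exact ⟨m, ε, h1, h2, rfl⟩

lemma mem_brSet_im {P : Set V} (hP : P ⊆ Delo α s) {m : ℤ} : m • δ ∉ brSet α δ θ s P := by
  rw [h.mem_brSet hP]
  rintro ⟨n, η, hη, hp, e⟩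
  exact h.uniq0 (hP hη) e

lemma mem_A_re {K : Set ι} {m : ℤ} {ε : V} (hε : ε ∈ Delo α s) :
    m • δ + ε ∈ DelJPosB α δ θ s K ↔ ε ∈ DeloJ α s K ∧ posR α m ε := by
  rw [← h.mem_brSet_re (DeloJ_sub (α := α) (s := s) (J := K)) hε]
  refine ⟨fun hh => hh.resolve_right ?_, Or.inl⟩
  rintro ⟨n, -, e⟩
  exact h.uniq0 hε e.symm

lemma mem_A_im {K : Set ι} {m : ℤ} : m • δ ∈ DelJPosB α δ θ s K ↔ 0 < m := by
  constructor
  · rintro (h1 | ⟨n, hn, e⟩)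
    · exact absurd h1 (h.mem_brSet_im DeloJ_sub)
    · have := congrArg h.dd e
      rw [h.dd_z, h.dd_z] at this
      have : m = n := by exact_mod_cast this
      omega
  · intro hm
    right
    lift m to ℕ using hm.le
    exact ⟨m, by exact_mod_cast hm, rfl⟩

lemma A_cases {K : Set ι} {v : V} (hv : v ∈ DelJPosB α δ θ s K) :
    (∃ m : ℤ, 0 < m ∧ v = m • δ) ∨ ∃ m : ℤ, ∃ ε ∈ DeloJ α s K, posR α m ε ∧ v = m • δ + ε := by
  rcases hv with h1 | ⟨n, hn, e⟩
  · right; exact (h.mem_brSet DeloJ_sub).1 h1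
  · left; exact ⟨n, by exact_mod_cast hn, e⟩

lemma A_not_neg {K : Set ι} {v : V} (hv : v ∈ DelJPosB α δ θ s K) : -v ∉ DelJPosB α δ θ s K := by
  rcases h.A_cases hv with ⟨m, hm, rfl⟩ | ⟨m, ε, hε, hp, rfl⟩
  · rw [← neg_smul, h.mem_A_im]; omega
  · rw [neg_add, ← neg_smul, h.mem_A_re (DeloJ_sub (h.neg_memJ hε)), h.posR_neg (DeloJ_sub hε)]
    exact fun hh => hh.2 hp

/-! ### action -/

lemma B_delta {v : V} (hv : v ∈ Delo α s) : B δ v = 0 := by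
  rw [h.expand hv, map_sum]
  simp [h.delta_orth]

lemma wo_delta {J : Set ι} {g : V ≃ₗ[ℝ] V} (hg : g ∈ WoJ α s J) : g δ = δ := by
  replace hg := wo_univ hg
  induction hg using Subgroup.closure_induction with
  | mem x hx =>
    obtain ⟨j, -, rfl⟩ := hx
    change s (α j) δ = δ
    rw [h.s_app (alpha_mem j), prL_apply, h.delta_orth]; simp
  | one => rfl
  | mul x y _ _ hx hy =>
    change x (y δ) = δ
    rw [hy, hx]
  | inv x _ hx => exact x.symm_apply_eq.2 hx.symm

lemma wo_re {J : Set ι} {g : V ≃ₗ[ℝ] V} (hg : g ∈ WoJ α s J) (m : ℤ) (ε : V) :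
    g (m • δ + ε) = m • δ + g ε := by
  rw [map_add, map_zsmul, h.wo_delta hg]

lemma wo_im {J : Set ι} {g : V ≃ₗ[ℝ] V} (hg : g ∈ WoJ α s J) (m : ℤ) :
    g (m • δ) = m • δ := by
  rw [map_zsmul, h.wo_delta hg]

lemma B_aff {x : V} (hx : x ∈ Delo α s) (y : V) (hy : y ∈ Delo α s) (m : ℤ) :
    B (m • δ + y) (δ - x) = - B y x := by
  have h1 : B y δ = 0 := by rw [h.Bsymm]; exact h.B_delta hy
  simp [h.delta_null, h.B_delta hx, h1]

lemma B_aff' {x : V} (hx : x ∈ Delo α s) : B (δ - x) (δ - x) = B x x := by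
  have h1 : B x δ = 0 := by rw [h.Bsymm]; exact h.B_delta hx
  simp [h.delta_null, h.B_delta hx, h1]

lemma aff_ne {x : V} (hx : x ∈ Delo α s) : B (δ - x) (δ - x) ≠ 0 := by
  rw [h.B_aff' hx]; exact h.Bne hx

lemma aff_delta {x : V} (hx : x ∈ Delo α s) : s (δ - x) δ = δ := by
  rw [h.s_gen (h.aff_ne hx), prL_apply]
  simp [h.delta_null, h.B_delta hx]

lemma aff_re {x : V} (hx : x ∈ Delo α s) {y : V} (hy : y ∈ Delo α s) (m k : ℤ)
    (hk : prL B x y = k) : s (δ - x) (m • δ + y) = (m + k) • δ + s x y := by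
  rw [h.s_gen (h.aff_ne hx), h.s_app hx, hk, prL_apply, h.B_aff hx y hy, h.B_aff' hx]
  rw [prL_apply] at hk
  rw [mul_neg, hk, add_smul, ← Int.cast_smul_eq_zsmul ℝ k δ]
  module

end AffineSetup
end affine
end

section
set_option linter.unusedSectionVars false

section exch
variable {V : Type*} [AddCommGroup V] [Module ℝ V]

/-- Abstract simple system. -/
structure Sys (s : V → V ≃ₗ[ℝ] V) (Pi Pos : Set V) : Prop where
  neg : ∀ v ∈ Pos, -v ∉ Pos
  sub : Pi ⊆ Pos
  perm : ∀ a ∈ Pi, ∀ v ∈ Pos, v ≠ a → s a v ∈ Pos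
  self : ∀ a ∈ Pi, s a a = -a
  sq : ∀ a ∈ Pi, s a * s a = 1
  conj : ∀ g ∈ Subgroup.closure (s '' Pi), ∀ a ∈ Pi, s (g a) = g * s a * g⁻¹

namespace Sys
variable {s : V → V ≃ₗ[ℝ] V} {Pi Pos : Set V} (h : Sys s Pi Pos)
include h

omit h in
lemma prod_mem (l : List V) (hl : ∀ x ∈ l, x ∈ Pi) :
    (l.map s).prod ∈ Subgroup.closure (s '' Pi) := by
  refine Subgroup.list_prod_mem _ fun x hx => ?_
  obtain ⟨a, ha, rfl⟩ := List.mem_map.1 hx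
  exact Subgroup.subset_closure ⟨a, hl a ha, rfl⟩

lemma exchange {a : V} (ha : a ∈ Pi) (l : List V) (hl : ∀ x ∈ l, x ∈ Pi)
    (hn : (l.map s).prod a ∉ Pos) : ∃ l' : List V, (∀ x ∈ l', x ∈ Pi) ∧ l'.length + 1 = l.length ∧
      (l.map s).prod * s a = (l'.map s).prod := by
  induction l with
  | nil => exact absurd (h.sub ha) (by simpa using hn)
  | cons b l ih =>
    have hb : b ∈ Pi := hl b (by simp)
    have hl' : ∀ x ∈ l, x ∈ Pi := fun x hx => hl x (by simp [hx])
    by_cases hw : (l.map s).prod a ∈ Pos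
    · have e : (l.map s).prod a = b := by
        by_contra hne
        apply hn
        have := h.perm b hb _ hw hne
        simpa using this
      refine ⟨l, hl', by simp, ?_⟩
      have := h.conj _ (prod_mem l hl') a ha
      rw [e] at this
      rw [List.map_cons, List.prod_cons, this]
      have hsq := h.sq a ha
      calc (l.map s).prod * s a * (l.map s).prod⁻¹ * (l.map s).prod * s a
          = (l.map s).prod * (s a * s a) := by group
        _ = _ := by rw [hsq, mul_one]
    · obtain ⟨l', h1, h2, h3⟩ := ih hl' hw
      refine ⟨b :: l', ?_, by simp [h2], ?_⟩
      · intro x hx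
        rcases List.mem_cons.1 hx with rfl | hx
        · exact hb
        · exact h1 x hx
      · rw [List.map_cons, List.prod_cons, mul_assoc, h3, List.map_cons, List.prod_cons]

lemma exists_list {g : V ≃ₗ[ℝ] V} (hg : g ∈ Subgroup.closure (s '' Pi)) :
    ∃ l : List V, (∀ x ∈ l, x ∈ Pi) ∧ g = (l.map s).prod := by
  induction hg using Subgroup.closure_induction_left with
  | one => exact ⟨[], by simp, by simp⟩
  | mul_left x hx y _ ih =>
    obtain ⟨a, ha, rfl⟩ := hx
    obtain ⟨l, hl, rfl⟩ := ih
    exact ⟨a :: l, by simpa using ⟨ha, hl⟩, by simp⟩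
  | inv_mul_cancel x hx y _ ih =>
    obtain ⟨a, ha, rfl⟩ := hx
    obtain ⟨l, hl, rfl⟩ := ih
    refine ⟨a :: l, by simpa using ⟨ha, hl⟩, ?_⟩
    rw [inv_eq_of_mul_eq_one_left (h.sq a ha)]; simp

lemma list_one : ∀ n : ℕ, ∀ l : List V, l.length = n → (∀ x ∈ l, x ∈ Pi) →
    (∀ a ∈ Pi, (l.map s).prod a ∈ Pos) → (l.map s).prod = 1 := by
  intro n
  induction n using Nat.strong_induction_on with
  | _ n ih =>
    intro l hln hl hp
    rcases List.eq_nil_or_concat l with rfl | ⟨l0, a, rfl⟩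
    · simp
    · have ha : a ∈ Pi := hl a (by simp)
      have hl0 : ∀ x ∈ l0, x ∈ Pi := fun x hx => hl x (by simp [hx])
      have e : (((l0.concat a)).map s).prod = (l0.map s).prod * s a := by simp
      have h1 : (l0.map s).prod a ∉ Pos := by
        intro h2
        have h3 := hp a ha
        rw [e] at h3
        change (l0.map s).prod (s a a) ∈ Pos at h3
        rw [h.self a ha, map_neg] at h3
        exact h.neg _ h2 h3
      obtain ⟨l', h2, h3, h4⟩ := h.exchange ha l0 hl0 h1
      rw [e, h4]
      simp at hln
      refine ih l'.length (by omega) l' rfl h2 ?_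
      rw [← h4, ← e]
      exact hp

lemma eq_one {g : V ≃ₗ[ℝ] V} (hg : g ∈ Subgroup.closure (s '' Pi)) (hp : ∀ a ∈ Pi, g a ∈ Pos) :
    g = 1 := by
  obtain ⟨l, hl, rfl⟩ := h.exists_list hg
  exact h.list_one _ l rfl hl hp

lemma stab_gen {a : V} (ha : a ∈ Pi) {v : V} (hv : v ∈ Pos ∨ -v ∈ Pos) :
    s a v ∈ Pos ∨ -(s a v) ∈ Pos := by
  rcases hv with hv | hv
  · by_cases e : v = a
    · right; rw [e, h.self a ha, neg_neg]; exact h.sub ha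
    · left; exact h.perm a ha v hv e
  · by_cases e : -v = a
    · left
      have : s a v = - s a (-v) := by simp
      rw [this, e, h.self a ha, neg_neg]; exact h.sub ha
    · right
      rw [← map_neg]; exact h.perm a ha _ hv e

lemma stab {g : V ≃ₗ[ℝ] V} (hg : g ∈ Subgroup.closure (s '' Pi)) {v : V} (hv : v ∈ Pos ∨ -v ∈ Pos) :
    g v ∈ Pos ∨ -(g v) ∈ Pos := by
  obtain ⟨l, hl, rfl⟩ := h.exists_list hg
  clear hg
  induction l with
  | nil => simpa using hv
  | cons b l ih =>
    have := h.stab_gen (hl b (by simp)) (ih (fun x hx => hl x (by simp [hx])))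
    simpa using this

end Sys
end exch

variable {ι V : Type*} [Fintype ι] [Nonempty ι] [AddCommGroup V] [Module ℝ V]

section affine
variable {α : ι → V} {δ θ : V} {B : V →ₗ[ℝ] V →ₗ[ℝ] ℝ} {s : V → V ≃ₗ[ℝ] V}

namespace AffineSetup
variable (h : AffineSetup α δ θ B s)
include h

omit h in
lemma WoJ_eq (J : Set ι) : WoJ α s J = Subgroup.closure (s '' (α '' J)) := by
  rw [WoJ, Set.image_image]

lemma finSys (J : Set ι) : Sys s (α '' J) {a | a ∈ DeloJ α s J ∧ PosoComb α a} where
  neg := by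
    rintro v ⟨h1, h2⟩ ⟨-, h3⟩
    exact h.not_both (DeloJ_sub h1) h2 h3
  sub := by
    rintro _ ⟨j, hj, rfl⟩
    exact ⟨alpha_memJ hj, h.pos_alpha j⟩
  perm := by
    rintro _ ⟨j, hj, rfl⟩ v ⟨h1, h2⟩ hne
    exact ⟨h.s_root (alpha_memJ hj) h1, h.s_pos (DeloJ_sub h1) h2 hne⟩
  self := by
    rintro _ ⟨j, hj, rfl⟩
    exact h.s_self (h.Bne (alpha_mem j))
  sq := by
    rintro _ ⟨j, hj, rfl⟩
    exact h.s_sq (h.Bne (alpha_mem j))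
  conj := by
    rintro g hg _ ⟨j, hj, rfl⟩
    rw [← WoJ_eq] at hg
    exact h.conj (h.B_wo (wo_univ hg)) (h.Bne (alpha_mem j))

lemma minrep_pos {J K : Set ι} {u : V ≃ₗ[ℝ] V} (hu : u ∈ MinReps α s J K) {k : ι} (hk : k ∈ K) :
    PosoComb α (u (α k)) := by
  by_contra hc
  have hS := h.finSys Set.univ
  have hr : (Set.range fun i => s (α i)) = s '' (α '' Set.univ) := by
    rw [Set.image_univ, ← Set.range_comp]; rfl
  have hle := hu.2 _ (gen_mem hk)
  rw [hr] at hle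
  obtain ⟨l0, hl0, hul⟩ := hS.exists_list (by rw [← WoJ_eq]; exact wo_univ hu.1)
  have hne : {n | ∃ l : List (V ≃ₗ[ℝ] V), (∀ x ∈ l, x ∈ s '' (α '' Set.univ)) ∧ l.length = n ∧
      l.prod = u}.Nonempty :=
    ⟨_, l0.map s, fun x hx => by
      obtain ⟨a, ha, rfl⟩ := List.mem_map.1 hx
      exact ⟨a, hl0 a ha, rfl⟩, rfl, hul.symm⟩
  obtain ⟨l, hl, hlen, hprod⟩ := Nat.sInf_mem hne
  have hl2 : ∃ l2 : List V, (∀ x ∈ l2, x ∈ α '' Set.univ) ∧ l = l2.map s := by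
    clear hlen hprod
    induction l with
    | nil => exact ⟨[], by simp, rfl⟩
    | cons b l ih =>
      obtain ⟨l2, h1, rfl⟩ := ih (fun x hx => hl x (by simp [hx]))
      obtain ⟨a, ha, rfl⟩ := hl b (by simp)
      refine ⟨a :: l2, ?_, by simp⟩
      intro x hx
      rcases List.mem_cons.1 hx with rfl | hx
      · exact ha
      · exact h1 x hx
  obtain ⟨l2, hl2, rfl⟩ := hl2
  obtain ⟨l', h1, h2, h3⟩ := hS.exchange (a := α k) ⟨k, trivial, rfl⟩ l2 hl2 (by
    rw [hprod]; exact fun hh => hc hh.2)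
  have : lenG (s '' (α '' Set.univ)) (u * s (α k)) ≤ l'.length := by
    apply Nat.sInf_le
    refine ⟨l'.map s, fun x hx => ?_, by simp, ?_⟩
    · obtain ⟨a, ha, rfl⟩ := List.mem_map.1 hx
      exact ⟨a, h1 a ha, rfl⟩
    · rw [← h3, hprod]
  have hlen' : l2.length = lenG (s '' (α '' Set.univ)) u := by
    rw [← List.length_map (f := s), hlen]; rfl
  omega

lemma minrep_posJ {J K : Set ι} {u : V ≃ₗ[ℝ] V} (hu : u ∈ MinReps α s J K) :
    ∀ a ∈ DeloJ α s K, PosoComb α a → PosoComb α (u a) := by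
  refine h.pos_induct (fun k hk => h.minrep_pos hu hk) ?_
  intro a _ _ k hk _ hQ
  rw [map_add]
  exact h.pos_add hQ (h.minrep_pos hu hk)

lemma minrep_pos_iff {J K : Set ι} {u : V ≃ₗ[ℝ] V} (hu : u ∈ MinReps α s J K) {a : V}
    (ha : a ∈ DeloJ α s K) : PosoComb α (u a) ↔ PosoComb α a := by
  refine ⟨fun hp => ?_, h.minrep_posJ hu a ha⟩
  by_contra hn
  rw [h.not_pos (DeloJ_sub ha)] at hn
  have := h.minrep_posJ hu _ (h.neg_memJ ha) hn
  rw [map_neg] at this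
  exact h.not_both (DeloJ_act (wo_univ hu.1) (DeloJ_sub ha)) hp this

lemma Pi_cases {K : Set ι} {a : V} (ha : a ∈ PiJ α δ s K) :
    (∃ k ∈ K, a = α k) ∨ ∃ x ∈ HighRoots α s K, a = δ - x := by
  rcases ha with ⟨k, hk, rfl⟩ | ⟨x, hx, rfl⟩
  · exact Or.inl ⟨k, hk, rfl⟩
  · exact Or.inr ⟨x, hx, rfl⟩

lemma Pi_ne {K : Set ι} {a : V} (ha : a ∈ PiJ α δ s K) : B a a ≠ 0 := by
  rcases h.Pi_cases ha with ⟨k, hk, rfl⟩ | ⟨x, hx, rfl⟩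
  · exact h.Bne (alpha_mem k)
  · exact h.aff_ne (DeloJ_sub hx.1)

lemma WJ_B {K : Set ι} {g : V ≃ₗ[ℝ] V} (hg : g ∈ WJ α δ s K) : ∀ u v, B (g u) (g v) = B u v := by
  induction hg using Subgroup.closure_induction with
  | mem x hx =>
    obtain ⟨a, ha, rfl⟩ := hx
    exact h.B_s (h.Pi_ne ha)
  | one => intro u v; rfl
  | mul x y _ _ hx hy =>
    intro u v
    change B (x (y u)) (x (y v)) = _
    rw [hx, hy]
  | inv x _ hx =>
    intro u v
    have := hx (x.symm u) (x.symm v)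
    simp only [LinearEquiv.apply_symm_apply] at this
    exact this.symm

lemma WJ_delta {K : Set ι} {g : V ≃ₗ[ℝ] V} (hg : g ∈ WJ α δ s K) : g δ = δ := by
  induction hg using Subgroup.closure_induction with
  | mem x hx =>
    obtain ⟨a, ha, rfl⟩ := hx
    rcases h.Pi_cases ha with ⟨k, hk, rfl⟩ | ⟨x, hx, rfl⟩
    · exact h.wo_delta (gen_mem hk)
    · exact h.aff_delta (DeloJ_sub hx.1)
  | one => rfl
  | mul x y _ _ hx hy =>
    change x (y δ) = δ
    rw [hy, hx]
  | inv x _ hx => exact x.symm_apply_eq.2 hx.symm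

lemma alpha_A {K : Set ι} {a : V} : a ∈ DeloJ α s K → PosoComb α a → a ∈ DelJPosB α δ θ s K := by
  intro ha hp
  have := (h.mem_A_re (K := K) (m := 0) (DeloJ_sub ha)).2 ⟨ha, Or.inr ⟨rfl, hp⟩⟩
  simpa using this

lemma sub_A {K : Set ι} {a : V} : a ∈ DeloJ α s K → δ - a ∈ DelJPosB α δ θ s K := by
  intro ha
  have := (h.mem_A_re (K := K) (m := 1) (DeloJ_sub (h.neg_memJ ha))).2
    ⟨h.neg_memJ ha, Or.inl (by norm_num)⟩
  simpa [sub_eq_add_neg] using this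

lemma affSys (K : Set ι) : Sys s (PiJ α δ s K) (DelJPosB α δ θ s K) where
  neg := fun v hv => h.A_not_neg hv
  sub := by
    intro a ha
    rcases h.Pi_cases ha with ⟨k, hk, rfl⟩ | ⟨x, hx, rfl⟩
    · exact h.alpha_A (alpha_memJ hk) (h.pos_alpha k)
    · exact h.sub_A hx.1
  perm := by
    intro a ha v hv hne
    rcases h.Pi_cases ha with ⟨k, hk, rfl⟩ | ⟨x, hx, rfl⟩
    · rcases h.A_cases hv with ⟨m, hm, rfl⟩ | ⟨m, ε, hε, hp, rfl⟩
      · rw [h.wo_im (gen_mem hk)]; exact hv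
      · rw [h.wo_re (gen_mem hk)]
        have hr := DeloJ_act (gen_mem (s := s) hk) hε
        refine (h.mem_A_re (DeloJ_sub hr)).2 ⟨hr, ?_⟩
        rcases hp with hp | ⟨rfl, hp⟩
        · exact Or.inl hp
        · exact Or.inr ⟨rfl, h.s_pos (DeloJ_sub hε) hp (by simpa using hne)⟩
    · have hxr := DeloJ_sub hx.1
      rcases h.A_cases hv with ⟨m, hm, rfl⟩ | ⟨m, ε, hε, hp, rfl⟩
      · rw [map_zsmul, h.aff_delta hxr]; exact hv
      · have hεr := DeloJ_sub hε
        obtain ⟨k, hk⟩ := h.prL_int hεr hxr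
        rw [h.aff_re hxr hεr m k hk]
        have hr := h.s_root hx.1 hε
        refine (h.mem_A_re (DeloJ_sub hr)).2 ⟨hr, ?_⟩
        have hm0 : 0 ≤ m := by rcases hp with h1 | ⟨h1, -⟩ <;> omega
        by_cases hneg : ε = -x
        · have hk2 : k = -2 := by
            rw [hneg, map_neg, h.prL_self (h.Bne hxr)] at hk
            exact_mod_cast hk.symm
          have hm1 : m ≠ 1 := by
            rintro rfl
            apply hne
            rw [hneg, one_smul, sub_eq_add_neg]
          have hm1 : m ≠ 0 := by
            rintro rfl
            rcases hp with hp | ⟨-, hp⟩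
            · omega
            · rw [hneg] at hp
              exact h.not_both hxr hx.2.1 hp
          rcases (by omega : 0 < m + k ∨ m + k = 0) with h1 | h1
          · exact Or.inl h1
          · refine Or.inr ⟨h1, ?_⟩
            rw [hneg, map_neg, h.s_self (h.Bne hxr), neg_neg]
            exact hx.2.1
        · have hk1 : -1 ≤ k := by
            have h1 := h.hi_le hx (h.neg_memJ hε) (fun e => hneg (by rw [← e, neg_neg]))
            rw [map_neg, hk] at h1
            have : -k ≤ 1 := by exact_mod_cast h1
            omega
          rcases lt_trichotomy (m + k) 0 with h1 | h1 | h1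
          · exfalso
            have : m = 0 := by omega
            rcases hp with hp | ⟨-, hp⟩
            · omega
            · have := h.hi_pr hx hε hp
              rw [hk] at this
              have : 0 ≤ k := by exact_mod_cast this
              omega
          · refine Or.inr ⟨h1, ?_⟩
            by_cases hk0 : k = 0
            · rcases hp with hp | ⟨-, hp⟩
              · omega
              · rw [h.s_app hxr, hk, hk0]; simpa using hp
            · have hk1 : k = -1 := by omega
              have e : s x ε = x + ε := by rw [h.s_app hxr, hk, hk1]; simp [add_comm]
              by_contra hn
              rw [h.not_pos (DeloJ_sub hr)] at hn
              have := h.hi_not hx _ (h.neg_memJ hr) hn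
              apply this
              rw [e]
              simpa using h.neg_memJ hε
          · exact Or.inl h1
  self := fun a ha => h.s_self (h.Pi_ne ha)
  sq := fun a ha => h.s_sq (h.Pi_ne ha)
  conj := fun g hg a ha => h.conj (h.WJ_B hg) (h.Pi_ne ha)

end AffineSetup
end affine
end

section
set_option linter.unusedSectionVars false
variable {ι V : Type*} [Fintype ι] [Nonempty ι] [AddCommGroup V] [Module ℝ V]

section affine
variable {α : ι → V} {δ θ : V} {B : V →ₗ[ℝ] V →ₗ[ℝ] ℝ} {s : V → V ≃ₗ[ℝ] V}

namespace AffineSetup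
variable (h : AffineSetup α δ θ B s)
include h

lemma ht_pos {a : V} (ha : a ∈ Delo α s) (hp : PosoComb α a) : 0 < h.ht a := by
  obtain ⟨j, -, hj, -⟩ := h.exists_desc (J := Set.univ) ha (by simp) hp
  rw [ht_apply]
  exact Finset.sum_pos' (fun i _ => (h.pos_iff ha).1 hp i) ⟨j, Finset.mem_univ j, hj⟩

lemma A_dd {K : Set ι} {v : V} (hv : v ∈ DelJPosB α δ θ s K) :
    0 ≤ h.dd v ∧ (h.dd v = 0 → 0 < h.ht v) := by
  rcases h.A_cases hv with ⟨m, hm, rfl⟩ | ⟨m, ε, hε, hp, rfl⟩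
  · rw [h.dd_z]
    refine ⟨by exact_mod_cast hm.le, fun e => ?_⟩
    have : m = 0 := by exact_mod_cast e
    omega
  · rw [map_add, h.dd_z, h.dd_root (DeloJ_sub hε), add_zero]
    have hm0 : 0 ≤ m := by rcases hp with h1 | ⟨h1, -⟩ <;> omega
    refine ⟨by exact_mod_cast hm0, fun e => ?_⟩
    have e : m = 0 := by exact_mod_cast e
    subst e
    rcases hp with hp | ⟨-, hp⟩
    · omega
    · simpa using h.ht_pos (DeloJ_sub hε) hp

lemma A_add_neg {K : Set ι} {p q : V} (hp : p ∈ DelJPosB α δ θ s K) (hq : q ∈ DelJPosB α δ θ s K) :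
    -(p + q) ∉ DelJPosB α δ θ s K := by
  intro hr
  obtain ⟨p1, p2⟩ := h.A_dd hp
  obtain ⟨q1, q2⟩ := h.A_dd hq
  obtain ⟨r1, r2⟩ := h.A_dd hr
  simp only [map_neg, map_add] at r1 r2
  have := p2 (by linarith)
  have := q2 (by linarith)
  have := r2 (by linarith)
  linarith

lemma A_mono {J K : Set ι} (hJK : J ⊆ K) : DelJPosB α δ θ s J ⊆ DelJPosB α δ θ s K := by
  intro v hv
  rcases h.A_cases hv with ⟨m, hm, rfl⟩ | ⟨m, ε, hε, hp, rfl⟩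
  · exact h.mem_A_im.2 hm
  · exact (h.mem_A_re (DeloJ_sub hε)).2 ⟨DeloJ_mono hJK hε, hp⟩

lemma A_not_DelNeg {K : Set ι} {v : V} (hv : v ∈ DelJPosB α δ θ s K) : v ∉ DelNeg α δ θ s := by
  rcases h.A_cases hv with ⟨m, hm, rfl⟩ | ⟨m, ε, hε, hp, rfl⟩
  · rw [h.mem_DelNeg_im]; omega
  · rw [h.mem_DelNeg_re (DeloJ_sub hε)]; simpa using hp

lemma A_DelPos {K : Set ι} {v : V} (hv : v ∈ DelJPosB α δ θ s K) : v ∈ DelPos α δ θ s := by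
  rcases h.A_cases hv with ⟨m, hm, rfl⟩ | ⟨m, ε, hε, hp, rfl⟩
  · exact h.mem_DelPos_im.2 hm
  · exact (h.mem_DelPos_re (DeloJ_sub hε)).2 hp

lemma WJ_stab {K : Set ι} {y : V ≃ₗ[ℝ] V} (hy : y ∈ WJ α δ s K) {v : V}
    (hv : v ∈ DelJPosB α δ θ s K) : y v ∉ DelJPosB α δ θ s K ↔ -(y v) ∈ DelJPosB α δ θ s K := by
  have := (h.affSys K).stab hy (Or.inl hv)
  exact ⟨fun hh => this.resolve_left hh, fun h1 h2 => h.A_not_neg h2 h1⟩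

lemma phi_mem {K : Set ι} {y : V ≃ₗ[ℝ] V} (hy : y ∈ WJ α δ s K) {v : V} :
    v ∈ PhiJb α δ θ s K y ↔ v ∈ DelJPosB α δ θ s K ∧ y⁻¹ v ∉ DelJPosB α δ θ s K := by
  constructor
  · rintro ⟨h1, h2⟩
    exact ⟨h1, fun h3 => h.A_not_DelNeg h3 h2⟩
  · rintro ⟨h1, h2⟩
    rw [h.WJ_stab (inv_mem hy) h1] at h2
    exact ⟨h1, h.A_DelPos h2⟩

lemma phi_biconvex {K : Set ι} {y : V ≃ₗ[ℝ] V} (hy : y ∈ WJ α δ s K) :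
    BiconvexIn (DelJPosB α δ θ s K) (PhiJb α δ θ s K y) := by
  refine ⟨⟨fun v hv => hv.1, ?_⟩, ⟨Set.diff_subset, ?_⟩⟩
  · intro a ha b hb hab
    rw [h.phi_mem hy] at ha hb ⊢
    refine ⟨hab, fun hc => ?_⟩
    have h1 := (h.WJ_stab (inv_mem hy) ha.1).1 ha.2
    have h2 := (h.WJ_stab (inv_mem hy) hb.1).1 hb.2
    apply h.A_add_neg h1 h2
    rw [← neg_add, neg_neg, ← map_add]
    exact hc
  · rintro a ⟨ha, ha'⟩ b ⟨hb, hb'⟩ hab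
    rw [h.phi_mem hy] at ha' hb'
    refine ⟨hab, fun hc => ?_⟩
    have hc' := ((h.phi_mem hy).1 hc).2
    rw [h.WJ_stab (inv_mem hy) hab, map_add] at hc'
    simp only [ha, hb, true_and, not_not] at ha' hb'
    exact h.A_add_neg ha' hb' hc'

lemma phi_sub_gen {K : Set ι} {a : V} (ha : a ∈ PiJ α δ s K) {y : V ≃ₗ[ℝ] V}
    (hy : y ∈ WJ α δ s K) :
    PhiJb α δ θ s K (s a * y) ⊆ {a} ∪ s a '' PhiJb α δ θ s K y := by
  have hS := h.affSys K
  have hsa : s a ∈ WJ α δ s K := Subgroup.subset_closure ⟨a, ha, rfl⟩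
  intro v hv
  rw [h.phi_mem (mul_mem hsa hy)] at hv
  by_cases e : v = a
  · left; exact e
  right
  have hsv : s a (s a v) = v := congrArg (fun g : V ≃ₗ[ℝ] V => g v) (hS.sq a ha)
  refine ⟨s a v, (h.phi_mem hy).2 ⟨hS.perm a ha v hv.1 e, ?_⟩, hsv⟩
  have h2 := hv.2
  rw [mul_inv_rev, h.s_inv (h.Pi_ne ha)] at h2
  exact h2

lemma phi_finite {K : Set ι} {y : V ≃ₗ[ℝ] V} (hy : y ∈ WJ α δ s K) :
    (PhiJb α δ θ s K y).Finite := by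
  induction hy using Subgroup.closure_induction_left with
  | one =>
    convert Set.finite_empty (α := V)
    ext v
    rw [h.phi_mem (one_mem _)]
    simp
  | mul_left x hx y hy ih =>
    obtain ⟨a, ha, rfl⟩ := hx
    exact ((Set.finite_singleton a).union (ih.image _)).subset (h.phi_sub_gen ha hy)
  | inv_mul_cancel x hx y hy ih =>
    obtain ⟨a, ha, rfl⟩ := hx
    rw [h.s_inv (h.Pi_ne ha)]
    exact ((Set.finite_singleton a).union (ih.image _)).subset (h.phi_sub_gen ha hy)

lemma phi_inj {K : Set ι} {y z : V ≃ₗ[ℝ] V} (hy : y ∈ WJ α δ s K) (hz : z ∈ WJ α δ s K)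
    (e : PhiJb α δ θ s K y = PhiJb α δ θ s K z) : y = z := by
  have hS := h.affSys K
  have key : z⁻¹ * y = 1 := by
    refine hS.eq_one (mul_mem (inv_mem hz) hy) fun c hc => ?_
    have hcA := hS.sub hc
    change z⁻¹ (y c) ∈ _
    have hyy : y⁻¹ (y c) = c := y.symm_apply_apply c
    by_cases hpos : y c ∈ DelJPosB α δ θ s K
    · have h1 : y c ∉ PhiJb α δ θ s K z := by
        rw [← e, h.phi_mem hy, hyy]
        exact fun hh => hh.2 hcA
      by_contra hn
      exact h1 ((h.phi_mem hz).2 ⟨hpos, hn⟩)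
    · have h2 := (h.WJ_stab hy hcA).1 hpos
      have h1 : -(y c) ∈ PhiJb α δ θ s K z := by
        rw [← e, h.phi_mem hy, map_neg, hyy]
        exact ⟨h2, h.A_not_neg hcA⟩
      have h3 := ((h.phi_mem hz).1 h1).2
      rw [h.WJ_stab (inv_mem hz) h2, map_neg, neg_neg] at h3
      exact h3
  have := mul_eq_one_iff_eq_inv.1 key
  simpa using (congrArg (·⁻¹) this).symm

lemma fin_no_im {K : Set ι} {S : Set V} (hS : BiconvexIn (DelJPosB α δ θ s K) S) (hf : S.Finite)
    (m : ℤ) : m • δ ∉ S := by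
  intro hm
  have hm0 := h.mem_A_im.1 (hS.1.1 hm)
  have key : ∀ k : ℕ, (((k : ℤ) + 1) * m) • δ ∈ S := by
    intro k
    induction k with
    | zero => simpa using hm
    | succ k ih =>
      have e : (((k + 1 : ℕ) : ℤ) + 1) * m = ((k : ℤ) + 1) * m + m := by push_cast; ring
      rw [e, add_smul]
      refine hS.1.2 _ ih _ hm ?_
      rw [← add_smul, h.mem_A_im]
      positivity
  refine Set.infinite_of_injective_forall_mem (f := fun k : ℕ => (((k : ℤ) + 1) * m) • δ) ?_ key hf
  intro a b hab
  have := congrArg h.dd hab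
  simp only [h.dd_z] at this
  have : ((a : ℤ) + 1) * m = (b + 1) * m := by exact_mod_cast this
  have := mul_right_cancel₀ hm0.ne' this
  omega

lemma init_seg {K : Set ι} {S : Set V} (hS : BiconvexIn (DelJPosB α δ θ s K) S)
    (hn : ∀ m : ℤ, m • δ ∉ S) {ε : V} (hε : ε ∈ DeloJ α s K) {m n : ℤ} (hnm : n ≤ m)
    (hm : m • δ + ε ∈ S) (hp : posR α n ε) : n • δ + ε ∈ S := by
  rcases hnm.eq_or_lt with rfl | hlt
  · exact hm
  by_contra hc
  have h1 : n • δ + ε ∈ DelJPosB α δ θ s K := (h.mem_A_re (DeloJ_sub hε)).2 ⟨hε, hp⟩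
  have h2 : (m - n) • δ ∈ DelJPosB α δ θ s K := h.mem_A_im.2 (by omega)
  have e : (m - n) • δ + (n • δ + ε) = m • δ + ε := by rw [sub_smul]; abel
  have := hS.2.2 _ ⟨h2, hn _⟩ _ ⟨h1, hc⟩ (by rw [e]; exact hS.1.1 hm)
  rw [e] at this
  exact this.2 hm

lemma exists_simple {K : Set ι} {S : Set V} (hS : BiconvexIn (DelJPosB α δ θ s K) S)
    (hn : ∀ m : ℤ, m • δ ∉ S) (hne : S.Nonempty) : ∃ a ∈ PiJ α δ s K, a ∈ S := by
  by_contra hc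
  push Not at hc
  have hα : ∀ k ∈ K, α k ∈ DelJPosB α δ θ s K \ S := fun k hk =>
    ⟨h.alpha_A (alpha_memJ hk) (h.pos_alpha k), hc _ (Or.inl ⟨k, hk, rfl⟩)⟩
  have h1 : ∀ a ∈ DeloJ α s K, PosoComb α a → a ∉ S := by
    refine h.pos_induct (fun k hk => (hα k hk).2) ?_
    intro a ha hp k hk hak hQ
    exact (hS.2.2 _ ⟨h.alpha_A ha hp, hQ⟩ _ (hα k hk)
      (h.alpha_A hak (h.pos_add hp (h.pos_alpha k)))).2
  have h2 : ∀ a ∈ DeloJ α s K, PosoComb α a → δ - a ∉ S := by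
    intro a ha hp haS
    have hfin : {a ∈ DeloJ α s K | PosoComb α a ∧ δ - a ∈ S}.Finite :=
      h.finite.subset fun x hx => DeloJ_sub hx.1
    obtain ⟨x, hx, hmax⟩ := hfin.exists_maximalFor (fun x => h.ht x) _ ⟨a, ha, hp, haS⟩
    obtain ⟨hxr, hxp, hxS⟩ := hx
    have hxh : x ∉ HighRoots α s K := fun hh => hc _ (Or.inr ⟨x, hh, rfl⟩) hxS
    have : ∃ j ∈ K, x + α j ∈ DeloJ α s K := by
      by_contra hcc
      push Not at hcc
      exact hxh ⟨hxr, hxp, hcc⟩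
    obtain ⟨j, hj, hxj⟩ := this
    have h3 : δ - (x + α j) ∉ S := by
      intro h4
      have h5 := hmax (j := x + α j) ⟨hxj, h.pos_add hxp (h.pos_alpha j), h4⟩
        (by simp [h.ht_alpha])
      simp [h.ht_alpha] at h5
      linarith
    have e : δ - (x + α j) + α j = δ - x := by abel
    have h4 := hS.2.2 _ ⟨h.sub_A hxj, h3⟩ _ (hα j hj) (by rw [e]; exact h.sub_A hxr)
    rw [e] at h4
    exact h4.2 hxS
  obtain ⟨v, hv⟩ := hne
  rcases h.A_cases (hS.1.1 hv) with ⟨m, hm, rfl⟩ | ⟨m, ε, hε, hp, rfl⟩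
  · exact hn m hv
  · rcases h.pos_or (DeloJ_sub hε) with hp' | hp'
    · have := h.init_seg hS hn hε (n := 0) (by rcases hp with h1 | ⟨h1, -⟩ <;> omega) hv
        (Or.inr ⟨rfl, hp'⟩)
      exact h1 ε hε hp' (by simpa using this)
    · have hm : 0 < m := by
        rcases hp with h1 | ⟨-, h1⟩
        · exact h1
        · exact absurd hp' (fun hh => h.not_both (DeloJ_sub hε) h1 hh)
      have := h.init_seg hS hn hε (n := 1) (by omega) hv (Or.inl (by norm_num))
      exact h2 (-ε) (h.neg_memJ hε) hp' (by simpa using this)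

lemma reduce {K : Set ι} {S : Set V} (hS : BiconvexIn (DelJPosB α δ θ s K) S) {a : V}
    (ha : a ∈ PiJ α δ s K) (haS : a ∈ S) :
    BiconvexIn (DelJPosB α δ θ s K) {v | s a v ∈ S ∧ s a v ≠ a} := by
  have hY := h.affSys K
  have hsv : ∀ v, s a (s a v) = v := fun v =>
    congrArg (fun g : V ≃ₗ[ℝ] V => g v) (hY.sq a ha)
  have haA := hY.sub ha
  have hsub : {v | s a v ∈ S ∧ s a v ≠ a} ⊆ DelJPosB α δ θ s K := by
    rintro v ⟨h1, h2⟩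
    rw [← hsv v]
    exact hY.perm a ha _ (hS.1.1 h1) h2
  have hne : ∀ x ∈ DelJPosB α δ θ s K, s a x ≠ a := by
    intro x hx e
    have : x = -a := by rw [← hsv x, e, hY.self a ha]
    rw [this] at hx
    exact hY.neg a haA hx
  refine ⟨⟨hsub, ?_⟩, ⟨Set.diff_subset, ?_⟩⟩
  · rintro x ⟨hx1, hx2⟩ y ⟨hy1, hy2⟩ hxy
    refine ⟨?_, hne _ hxy⟩
    have h1 : x + y ≠ a := by
      intro e
      apply h.A_add_neg (hS.1.1 hx1) (hS.1.1 hy1)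
      rw [← map_add, e, hY.self a ha, neg_neg]
      exact haA
    have h2 := hY.perm a ha _ hxy h1
    rw [map_add] at h2 ⊢
    exact hS.1.2 _ hx1 _ hy1 h2
  · have hcase : ∀ x ∈ DelJPosB α δ θ s K \ {v | s a v ∈ S ∧ s a v ≠ a}, x ≠ a →
        s a x ∈ DelJPosB α δ θ s K \ S := by
      rintro x ⟨hx, hx'⟩ e
      exact ⟨hY.perm a ha x hx e, fun hc => hx' ⟨hc, hne x hx⟩⟩
    have hmix : ∀ y ∈ DelJPosB α δ θ s K \ {v | s a v ∈ S ∧ s a v ≠ a}, y ≠ a →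
        s a (a + y) ∉ S := by
      intro y hy hya hc
      have h1 := hcase y hy hya
      rw [map_add, hY.self a ha] at hc
      have e : a + (-a + s a y) = s a y := by abel
      have := hS.1.2 _ haS _ hc (by rw [e]; exact h1.1)
      rw [e] at this
      exact h1.2 this
    intro x hx y hy hxy
    refine ⟨hxy, fun hc => ?_⟩
    have hc := hc.1
    by_cases hxa : x = a
    · subst hxa
      by_cases hya : y = x
      · subst hya
        apply h.A_add_neg haA haA
        rw [map_add, hY.self y ha, ← neg_add] at hc
        exact hS.1.1 hc
      · exact hmix y hy hya hc
    · by_cases hya : y = a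
      · subst hya
        rw [add_comm] at hc
        exact hmix x hx hxa hc
      · have h1 := hS.2.2 _ (hcase x hx hxa) _ (hcase y hy hya)
          (by rw [← map_add]; exact hS.1.1 hc)
        rw [← map_add] at h1
        exact h1.2 hc

lemma fin_classify {K : Set ι} : ∀ n : ℕ, ∀ S : Set V, S.ncard = n →
    BiconvexIn (DelJPosB α δ θ s K) S → S.Finite →
    ∃ y ∈ WJ α δ s K, S = PhiJb α δ θ s K y := by
  intro n
  induction n using Nat.strong_induction_on with
  | _ n ih =>
    intro S hSn hS hf
    rcases S.eq_empty_or_nonempty with rfl | hne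
    · refine ⟨1, one_mem _, ?_⟩
      symm
      rw [Set.eq_empty_iff_forall_notMem]
      intro v hv
      rw [h.phi_mem (one_mem _)] at hv
      exact hv.2 hv.1
    have hY := h.affSys K
    obtain ⟨a, ha, haS⟩ := h.exists_simple hS (h.fin_no_im hS hf) hne
    have hsv : ∀ v, s a (s a v) = v := fun v =>
      congrArg (fun g : V ≃ₗ[ℝ] V => g v) (hY.sq a ha)
    have hsa : s a ∈ WJ α δ s K := Subgroup.subset_closure ⟨a, ha, rfl⟩
    have hred := h.reduce hS ha haS
    have himg : {v | s a v ∈ S ∧ s a v ≠ a} = s a '' (S \ {a}) := by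
      ext v
      constructor
      · rintro ⟨h1, h2⟩
        exact ⟨s a v, ⟨h1, h2⟩, hsv v⟩
      · rintro ⟨w, ⟨h1, h2⟩, rfl⟩
        refine ⟨?_, ?_⟩ <;> rw [hsv]
        · exact h1
        · exact h2
    have hcard : {v | s a v ∈ S ∧ s a v ≠ a}.ncard < n := by
      rw [himg, Set.ncard_image_of_injective _ (s a).injective, ← hSn]
      exact Set.ncard_diff_singleton_lt_of_mem haS hf
    obtain ⟨y, hy, e⟩ := ih _ hcard _ rfl hred (by rw [himg]; exact (hf.subset Set.diff_subset).image _)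
    refine ⟨s a * y, mul_mem hsa hy, ?_⟩
    have hinv : (s a * y)⁻¹ = y⁻¹ * s a := by rw [mul_inv_rev, h.s_inv (h.Pi_ne ha)]
    have hiff : ∀ v, (s a v ∈ S ∧ s a v ≠ a) ↔
        v ∈ DelJPosB α δ θ s K ∧ y⁻¹ v ∉ DelJPosB α δ θ s K := by
      intro v
      rw [← h.phi_mem hy, ← e]; rfl
    have haA := hY.sub ha
    ext v
    rw [h.phi_mem (mul_mem hsa hy), hinv]
    change v ∈ S ↔ v ∈ _ ∧ y⁻¹ (s a v) ∉ _
    by_cases hva : v = a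
    · subst hva
      refine ⟨fun _ => ⟨haA, ?_⟩, fun _ => haS⟩
      rw [hY.self v ha, map_neg]
      have h1 : y⁻¹ v ∈ DelJPosB α δ θ s K := by
        by_contra hn
        have := (hiff v).2 ⟨haA, hn⟩
        rw [hY.self v ha] at this
        exact hY.neg v haA (hS.1.1 this.1)
      exact hY.neg _ h1
    · have h1 := hiff (s a v)
      rw [hsv] at h1
      constructor
      · intro hv
        exact ⟨hS.1.1 hv, (h1.1 ⟨hv, hva⟩).2⟩
      · rintro ⟨h2, h3⟩
        exact (h1.2 ⟨hY.perm a ha v h2 hva, h3⟩).1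

end AffineSetup
end affine
end

section
set_option linter.unusedSectionVars false
variable {ι V : Type*} [Fintype ι] [Nonempty ι] [AddCommGroup V] [Module ℝ V]

lemma exists_min_val {X : Type*} (f : X → ℕ) (S : Set X) (hS : S.Nonempty) :
    ∃ x ∈ S, ∀ y ∈ S, f x ≤ f y := by
  obtain ⟨x, hx, hm⟩ := WellFounded.has_min (measure f).wf S hS
  exact ⟨x, hx, fun y hy => not_lt.1 (hm y hy)⟩

section affine
variable {α : ι → V} {δ θ : V} {B : V →ₗ[ℝ] V →ₗ[ℝ] ℝ} {s : V → V ≃ₗ[ℝ] V}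

namespace AffineSetup
variable (h : AffineSetup α δ θ B s)
include h

lemma neg_stab_gen {J K : Set ι} (hKJ : K ⊆ J) {k : ι} (hk : k ∈ K) {ε : V}
    (hε : ε ∈ DeloKJneg α s J K) : s (α k) ε ∈ DeloKJneg α s J K := by
  obtain ⟨⟨h1, h2⟩, h3⟩ := hε
  refine ⟨⟨DeloJ_act (gen_mem (hKJ hk)) h1, fun hc => h2 ((DeloJ_act_iff (gen_mem hk)).1 hc)⟩, ?_⟩
  have h4 := h.s_pos (j := k) (DeloJ_sub (h.neg_memJ h1)) h3 (by
    intro e; exact h2 (h.neg_memJ_iff.1 (e ▸ alpha_memJ hk)))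
  rw [map_neg] at h4
  exact h4

lemma neg_stab {J K : Set ι} (hKJ : K ⊆ J) {g : V ≃ₗ[ℝ] V} (hg : g ∈ WoJ α s K) :
    ∀ ε : V, g ε ∈ DeloKJneg α s J K ↔ ε ∈ DeloKJneg α s J K := by
  induction hg using Subgroup.closure_induction with
  | mem x hx =>
    obtain ⟨k, hk, rfl⟩ := hx
    intro ε
    refine ⟨fun hh => ?_, h.neg_stab_gen hKJ hk⟩
    have := h.neg_stab_gen hKJ hk hh
    have e : s (α k) (s (α k) ε) = (s (α k) * s (α k)) ε := rfl
    rwa [e, h.s_sq (h.Bne (alpha_mem k))] at this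
  | one => intro ε; rfl
  | mul x y _ _ hx hy => intro ε; exact (hx (y ε)).trans (hy ε)
  | inv x _ hx =>
    intro ε
    rw [← hx]
    have e : x (x⁻¹ ε) = (x * x⁻¹) ε := rfl
    rw [e, mul_inv_cancel]; rfl

lemma exists_w {J : Set ι} {Q : Set V} 
    (hc : ∀ ε ∈ Q, ∀ η ∈ Q, ε + η ∈ DeloJ α s J → ε + η ∈ Q)
    (hn : ∀ ε ∈ DeloJ α s J, ε ∈ Q ∨ -ε ∈ Q) :
    ∃ w ∈ WoJ α s J, ∀ ε ∈ DeloJ α s J, PosoComb α ε → w ε ∈ Q := by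
  let bad : (V ≃ₗ[ℝ] V) → Set V := fun w => {ε | ε ∈ DeloJ α s J ∧ PosoComb α ε ∧ w ε ∉ Q}
  have hfin : ∀ w, (bad w).Finite := fun w => h.finite.subset fun ε hε => DeloJ_sub hε.1
  obtain ⟨w, hw, hmin⟩ := exists_min_val (fun w => (bad w).ncard) (WoJ α s J : Set (V ≃ₗ[ℝ] V))
    ⟨1, one_mem _⟩
  have key : ∀ j ∈ J, w (α j) ∈ Q := by
    intro j hj
    by_contra hbad
    have hB := h.Bne (alpha_mem (α := α) (s := s) j)
    have hlt : (bad (w * s (α j))).ncard < (bad w).ncard := by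
      rw [← Set.ncard_image_of_injective (bad (w * s (α j))) (s (α j)).injective]
      apply Set.ncard_lt_ncard _ (hfin w)
      refine ⟨?_, fun hsub => ?_⟩
      · rintro _ ⟨ε, ⟨h1, h2, h3⟩, rfl⟩
        refine ⟨DeloJ_act (gen_mem hj) h1, h.s_pos (DeloJ_sub h1) h2 ?_, h3⟩
        rintro rfl
        apply h3
        change w (s (α j) (α j)) ∈ Q
        rw [h.s_self hB, map_neg]
        exact (hn _ (DeloJ_act hw (alpha_memJ hj))).resolve_left hbad
      · obtain ⟨ε, ⟨h1, h2, h3⟩, e⟩ := hsub ⟨alpha_memJ hj, h.pos_alpha j, hbad⟩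
        have : ε = -α j := by
          have e2 : s (α j) (s (α j) ε) = (s (α j) * s (α j)) ε := rfl
          rw [e, h.s_self hB, h.s_sq hB] at e2
          exact e2.symm
        rw [this] at h2
        exact h.not_both (alpha_mem j) (h.pos_alpha j) h2
    exact absurd (hmin _ (mul_mem hw (gen_mem hj))) (not_le.2 hlt)
  refine ⟨w, hw, h.pos_induct key ?_⟩
  intro a ha hp k hk hak hQa
  rw [map_add]
  exact hc _ hQa _ (key k hk) (by rw [← map_add]; exact DeloJ_act hw hak)

lemma parabolic {J : Set ι} {Q : Set V}
    (hc : ∀ ε ∈ Q, ∀ η ∈ Q, ε + η ∈ DeloJ α s J → ε + η ∈ Q)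
    (hn : ∀ ε ∈ DeloJ α s J, ε ∈ Q ∨ -ε ∈ Q) :
    ∃ K, K ⊆ J ∧ ∃ u ∈ MinReps α s J K, ∀ ε ∈ DeloJ α s J,
      (u ε ∉ Q ↔ ε ∈ DeloKJneg α s J K) := by
  obtain ⟨w, hw, hwQ⟩ := h.exists_w hc hn
  let K : Set ι := {j | j ∈ J ∧ -(w (α j)) ∈ Q}
  have hKJ : K ⊆ J := fun j hj => hj.1
  have hact : ∀ {ε}, ε ∈ DeloJ α s J → w ε ∈ DeloJ α s J := fun hε => DeloJ_act hw hε
  have k1 : ∀ β ∈ DeloJ α s K, PosoComb α β → -(w β) ∈ Q := by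
    refine h.pos_induct (K := K) (Q := fun β => -(w β) ∈ Q) ?_ ?_
    · intro k hk; exact hk.2
    · intro a ha hp k hk hak hQ
      rw [map_add, neg_add]
      exact hc _ hQ _ hk.2 (by
        rw [← neg_add, ← map_add]; exact h.neg_memJ (hact (DeloJ_mono hKJ hak)))
  have k2 : ∀ β ∈ DeloJ α s J, PosoComb α β → (-(w β) ∈ Q → β ∈ DeloJ α s K) := by
    refine h.pos_induct (K := J) (Q := fun β => -(w β) ∈ Q → β ∈ DeloJ α s K) ?_ ?_
    · intro k hk hQ; exact alpha_memJ ⟨hk, hQ⟩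
    · intro a ha hp k hk hak ih hQ
      rw [map_add, neg_add] at hQ
      have e1 : -(w (α k)) ∈ Q := by
        have := hc _ hQ _ (hwQ a ha hp) (by
          rw [neg_add_eq_sub, sub_add, sub_self, sub_zero]
          convert h.neg_memJ (hact (alpha_memJ hk)) using 1)
        convert this using 1; abel
      have e2 : -(w a) ∈ Q := by
        have := hc _ hQ _ (hwQ _ (alpha_memJ hk) (h.pos_alpha k)) (by
          rw [neg_add_cancel_right]
          exact h.neg_memJ (hact ha))
        rwa [neg_add_cancel_right] at this
      exact h.memJ_add (ih e2) (alpha_memJ ⟨hk, e1⟩) (DeloJ_sub hak)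
  have k3 : ∀ ε ∈ DeloJ α s J, (w ε ∉ Q ↔ ε ∈ DeloKJneg α s J K) := by
    intro ε hε
    constructor
    · intro hq
      have hp : PosoComb α (-ε) := (h.pos_or (DeloJ_sub hε)).resolve_left fun hp => hq (hwQ _ hε hp)
      refine ⟨⟨hε, fun hK => hq ?_⟩, hp⟩
      have := k1 _ (h.neg_memJ hK) hp
      rwa [map_neg, neg_neg] at this
    · rintro ⟨⟨_, h2⟩, h3⟩ hq
      refine h2 (h.neg_memJ_iff.1 (k2 _ (h.neg_memJ hε) h3 ?_))
      rwa [map_neg, neg_neg]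
  obtain ⟨v, hv, hmin⟩ := exists_min_val
    (fun v => lenG (Set.range fun i => s (α i)) (w * v)) (WoJ α s K : Set (V ≃ₗ[ℝ] V)) ⟨1, one_mem _⟩
  refine ⟨K, hKJ, w * v, ⟨mul_mem hw (WoJ_mono hKJ hv), ?_⟩, ?_⟩
  · intro x hx
    have := hmin _ (mul_mem hv hx)
    rwa [← mul_assoc] at this
  · intro ε hε
    have := k3 (v ε) (DeloJ_act (WoJ_mono hKJ hv) hε)
    rw [h.neg_stab hKJ hv] at this
    exact this

end AffineSetup
end affine
end

section
set_option linter.unusedSectionVars false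
variable {ι V : Type*} [Fintype ι] [Nonempty ι] [AddCommGroup V] [Module ℝ V]

/-- The set `∇_J(K, u, y)`. -/
def nab (α : ι → V) (δ θ : V) (s : V → V ≃ₗ[ℝ] V) (J K : Set ι) (u y : V ≃ₗ[ℝ] V) : Set V :=
  DKJm α δ θ s J K u ∪ ⇑u '' PhiJb α δ θ s K y

section affine
variable {α : ι → V} {δ θ : V} {B : V →ₗ[ℝ] V →ₗ[ℝ] ℝ} {s : V → V ≃ₗ[ℝ] V}

namespace AffineSetup
variable (h : AffineSetup α δ θ B s)
include h

lemma N_iff {J K : Set ι} {ε : V} (hε : ε ∈ DeloJ α s J) :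
    ε ∈ DeloKJneg α s J K ↔ ∃ i, i ∉ K ∧ h.co i ε < 0 := by
  constructor
  · rintro ⟨⟨_, h2⟩, h3⟩
    by_contra! hc
    refine h2 (h.memJ_iff.2 ⟨DeloJ_sub hε, fun i hi => le_antisymm ?_ (hc i hi)⟩)
    exact (h.neg_iff (DeloJ_sub hε)).1 h3 i
  · rintro ⟨i, hi, hlt⟩
    refine ⟨⟨hε, fun hK => ?_⟩, ?_⟩
    · rw [h.co_out hK hi] at hlt; exact lt_irrefl _ hlt
    · apply (h.pos_or (DeloJ_sub hε)).resolve_left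
      intro hp
      exact absurd ((h.pos_iff (DeloJ_sub hε)).1 hp i) (not_le.2 hlt)

lemma N_co {J K : Set ι} {ε : V} (hε : ε ∈ DeloKJneg α s J K) (i : ι) : h.co i ε ≤ 0 :=
  (h.neg_iff (DeloJ_sub hε.1.1)).1 hε.2 i

lemma N_add {J K : Set ι} {ε η : V} (hε : ε ∈ DeloKJneg α s J K)
    (hη : η ∈ DeloKJneg α s J K ∨ η ∈ DeloJ α s K) (hs : ε + η ∈ DeloJ α s J) :
    ε + η ∈ DeloKJneg α s J K := by
  obtain ⟨i, hi, hlt⟩ := (h.N_iff hε.1.1).1 hε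
  refine (h.N_iff hs).2 ⟨i, hi, ?_⟩
  rw [map_add]
  have : h.co i η ≤ 0 := by
    rcases hη with hη | hη
    · exact h.N_co hη i
    · exact (h.co_out hη hi).le
  linarith

lemma N_add_ne {J K : Set ι} {ε η : V} (hε : ε ∈ DeloKJneg α s J K)
    (hη : η ∈ DeloKJneg α s J K ∨ η ∈ DeloJ α s K) : ε + η ≠ 0 := by
  obtain ⟨i, hi, hlt⟩ := (h.N_iff hε.1.1).1 hε
  intro e
  have e2 := congrArg (h.co i) e
  rw [map_add, map_zero] at e2
  have : h.co i η ≤ 0 := by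
    rcases hη with hη | hη
    · exact h.N_co hη i
    · exact (h.co_out hη hi).le
  linarith

lemma not_N_co {J K : Set ι} {ε : V} (hε : ε ∈ DeloJ α s J) (hn : ε ∉ DeloKJneg α s J K) {i : ι}
    (hi : i ∉ K) : 0 ≤ h.co i ε := by
  by_contra! hc
  exact hn ((h.N_iff hε).2 ⟨i, hi, hc⟩)

lemma not_N_add {J K : Set ι} {ε η : V} (hε : ε ∈ DeloJ α s J) (hn : ε ∉ DeloKJneg α s J K)
    (hη : η ∈ DeloJ α s J) (hn' : η ∉ DeloKJneg α s J K) : ε + η ∉ DeloKJneg α s J K := by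
  intro hc
  obtain ⟨i, hi, hlt⟩ := (h.N_iff hc.1.1).1 hc
  rw [map_add] at hlt
  have := h.not_N_co hε hn hi
  have := h.not_N_co hη hn' hi
  linarith

lemma not_N_K {J K : Set ι} {ε η : V} (hε : ε ∈ DeloJ α s J) (hn : ε ∉ DeloKJneg α s J K)
    (hη : η ∈ DeloJ α s J) (hn' : η ∉ DeloKJneg α s J K) (hs : ε + η ∈ DeloJ α s K) :
    ε ∈ DeloJ α s K := by
  refine h.memJ_iff.2 ⟨DeloJ_sub hε, fun i hi => ?_⟩
  have e := h.co_out hs hi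
  rw [map_add] at e
  have := h.not_N_co hε hn hi
  have := h.not_N_co hη hn' hi
  linarith

lemma posR_u {J K : Set ι} {u : V ≃ₗ[ℝ] V} (hu : u ∈ MinReps α s J K) {ε : V}
    (hε : ε ∈ DeloJ α s K) {m : ℤ} : posR α m (u ε) ↔ posR α m ε := by
  unfold posR; rw [h.minrep_pos_iff hu hε]

lemma NK_sub {J K : Set ι} {u : V ≃ₗ[ℝ] V} (hu : u ∈ WoJ α s J) :
    ⇑u '' DeloKJneg α s J K ⊆ Delo α s := by
  rintro _ ⟨ε, hε, rfl⟩; exact DeloJ_sub (DeloJ_act hu hε.1.1)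

lemma phi_re {K : Set ι} {y : V ≃ₗ[ℝ] V} {m : ℤ} {ε : V} (hε : ε ∈ Delo α s)
    (hm : m • δ + ε ∈ PhiJb α δ θ s K y) : ε ∈ DeloJ α s K ∧ posR α m ε :=
  (h.mem_A_re hε).1 hm.1

lemma phi_im {K : Set ι} {y : V ≃ₗ[ℝ] V} (hy : y ∈ WJ α δ s K) (m : ℤ) :
    m • δ ∉ PhiJb α δ θ s K y := h.fin_no_im (h.phi_biconvex hy) (h.phi_finite hy) m

lemma nab_re {J K : Set ι} {u y : V ≃ₗ[ℝ] V} (hu : u ∈ MinReps α s J K)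
    {m : ℤ} {ε : V} (hε : ε ∈ DeloJ α s J) :
    m • δ + u ε ∈ nab α δ θ s J K u y ↔
      (ε ∈ DeloKJneg α s J K ∧ posR α m (u ε)) ∨ m • δ + ε ∈ PhiJb α δ θ s K y := by
  unfold nab DKJm
  rw [Set.mem_union, h.mem_brSet_re (h.NK_sub hu.1) (DeloJ_sub (DeloJ_act hu.1 hε)),
    u.injective.mem_set_image, ← h.wo_re hu.1, u.injective.mem_set_image]

lemma nab_im {J K : Set ι} {u y : V ≃ₗ[ℝ] V} (hu : u ∈ MinReps α s J K)
    (hy : y ∈ WJ α δ s K) (m : ℤ) : m • δ ∉ nab α δ θ s J K u y := by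
  rintro (hc | ⟨v, hv, e⟩)
  · exact h.mem_brSet_im (h.NK_sub hu.1) hc
  · rw [← h.wo_im hu.1 m] at e
    rw [u.injective e] at hv
    exact h.phi_im hy m hv

lemma A_cases_u {J : Set ι} {u : V ≃ₗ[ℝ] V} (hu : u ∈ WoJ α s J) {v : V}
    (hv : v ∈ DelJPosB α δ θ s J) : (∃ m : ℤ, 0 < m ∧ v = m • δ) ∨
      ∃ m : ℤ, ∃ ε ∈ DeloJ α s J, posR α m (u ε) ∧ v = m • δ + u ε := by
  rcases h.A_cases hv with hv | ⟨m, ε, hε, hp, e⟩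
  · exact Or.inl hv
  · have e2 : u (u⁻¹ ε) = ε := by
      change (u * u⁻¹) ε = ε
      rw [mul_inv_cancel]; rfl
    exact Or.inr ⟨m, u⁻¹ ε, DeloJ_act (inv_mem hu) hε, by rwa [e2], by rwa [e2]⟩

lemma u_A {J K : Set ι} (hKJ : K ⊆ J) {u : V ≃ₗ[ℝ] V} (hu : u ∈ MinReps α s J K) {v : V}
    (hv : v ∈ DelJPosB α δ θ s K) : u v ∈ DelJPosB α δ θ s J := by
  rcases h.A_cases hv with ⟨m, hm, rfl⟩ | ⟨m, ε, hε, hp, rfl⟩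
  · rw [h.wo_im hu.1]; exact h.mem_A_im.2 hm
  · rw [h.wo_re hu.1]
    have := DeloJ_act hu.1 (DeloJ_mono hKJ hε)
    exact (h.mem_A_re (DeloJ_sub this)).2 ⟨this, (h.posR_u hu hε).2 hp⟩

lemma A_u {J : Set ι} {u : V ≃ₗ[ℝ] V} (hu : u ∈ WoJ α s J) {k : ℤ} {ε η : V}
    (hε : ε ∈ DeloJ α s J) (hη : η ∈ DeloJ α s J)
    (hA : k • δ + u (ε + η) ∈ DelJPosB α δ θ s J) :
    (ε + η = 0 ∧ 0 < k) ∨ (ε + η ∈ DeloJ α s J ∧ posR α k (u (ε + η))) := by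
  have hd : h.dd (u (ε + η)) = 0 := by
    rw [map_add, map_add, h.dd_root (DeloJ_sub (DeloJ_act hu hε)),
      h.dd_root (DeloJ_sub (DeloJ_act hu hη)), add_zero]
  rcases h.A_cases_u hu hA with ⟨m, hm, e⟩ | ⟨m, ζ, hζ, hp, e⟩
  · rw [← add_zero (m • δ)] at e
    obtain ⟨rfl, e2⟩ := h.uniq hd (map_zero _) e
    exact Or.inl ⟨u.injective (e2.trans (map_zero _).symm), hm⟩
  · obtain ⟨rfl, e2⟩ := h.uniq hd (h.dd_root (DeloJ_sub (DeloJ_act hu hζ))) e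
    rw [u.injective e2]
    exact Or.inr ⟨hζ, hp⟩

lemma nab_sub {J K : Set ι} (hKJ : K ⊆ J) {u y : V ≃ₗ[ℝ] V} (hu : u ∈ MinReps α s J K) :
    nab α δ θ s J K u y ⊆ DelJPosB α δ θ s J := by
  rintro v (hv | ⟨v, hv, rfl⟩)
  · obtain ⟨m, _, ⟨ε, hε, rfl⟩, hp, rfl⟩ := (h.mem_brSet (h.NK_sub hu.1)).1 hv
    have := DeloJ_act hu.1 hε.1.1
    exact (h.mem_A_re (DeloJ_sub this)).2 ⟨this, hp⟩
  · exact h.u_A hKJ hu hv.1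

lemma nab_cases {J K : Set ι} (hKJ : K ⊆ J) {u y : V ≃ₗ[ℝ] V} (hu : u ∈ MinReps α s J K)
    (hy : y ∈ WJ α δ s K) {v : V} (hv : v ∈ nab α δ θ s J K u y) :
    ∃ m : ℤ, ∃ ε ∈ DeloJ α s J, posR α m (u ε) ∧ v = m • δ + u ε ∧
      (ε ∈ DeloKJneg α s J K ∨ (ε ∈ DeloJ α s K ∧ m • δ + ε ∈ PhiJb α δ θ s K y)) := by
  rcases h.A_cases_u hu.1 (h.nab_sub hKJ hu hv) with ⟨m, hm, rfl⟩ | ⟨m, ε, hε, hp, rfl⟩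
  · exact absurd hv (h.nab_im hu hy m)
  · refine ⟨m, ε, hε, hp, rfl, ?_⟩
    rcases (h.nab_re hu hε).1 hv with h1 | h1
    · exact Or.inl h1.1
    · exact Or.inr ⟨(h.phi_re (DeloJ_sub hε) h1).1, h1⟩

lemma nab_convex {J K : Set ι} (hKJ : K ⊆ J) {u y : V ≃ₗ[ℝ] V} (hu : u ∈ MinReps α s J K)
    (hy : y ∈ WJ α δ s K) : ConvexIn (DelJPosB α δ θ s J) (nab α δ θ s J K u y) := by
  refine ⟨h.nab_sub hKJ hu, ?_⟩
  intro v hv w hw hA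
  obtain ⟨m, ε, hε, hp, rfl, h1⟩ := h.nab_cases hKJ hu hy hv
  obtain ⟨n, η, hη, hq, rfl, h2⟩ := h.nab_cases hKJ hu hy hw
  have e : m • δ + u ε + (n • δ + u η) = (m + n) • δ + u (ε + η) := by
    rw [add_zsmul, map_add]; abel
  rw [e] at hA ⊢
  by_cases hN : ε ∈ DeloKJneg α s J K ∨ η ∈ DeloKJneg α s J K
  · have key : ε + η ≠ 0 ∧ (ε + η ∈ DeloJ α s J → ε + η ∈ DeloKJneg α s J K) := by
      rcases hN with hN | hN
      · have := h2.imp_right And.left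
        exact ⟨h.N_add_ne hN this, h.N_add hN this⟩
      · have := h1.imp_right And.left
        rw [add_comm]
        exact ⟨h.N_add_ne hN this, h.N_add hN this⟩
    rcases h.A_u hu.1 hε hη hA with ⟨e0, _⟩ | ⟨hr, hp'⟩
    · exact absurd e0 key.1
    · exact (h.nab_re hu hr).2 (Or.inl ⟨key.2 hr, hp'⟩)
  · push Not at hN
    obtain ⟨hεK, h1⟩ := h1.resolve_left hN.1
    obtain ⟨hηK, h2⟩ := h2.resolve_left hN.2
    have e3 : m • δ + ε + (n • δ + η) = (m + n) • δ + (ε + η) := by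
      rw [add_zsmul]; abel
    have hs : m • δ + ε + (n • δ + η) ∈ DelJPosB α δ θ s K := by
      rw [e3]
      rcases h.A_u hu.1 hε hη hA with ⟨e0, hk⟩ | ⟨hr, hp'⟩
      · rw [e0, add_zero]; exact h.mem_A_im.2 hk
      · have := h.memJ_add hεK hηK (DeloJ_sub hr)
        exact (h.mem_A_re (DeloJ_sub hr)).2 ⟨this, (h.posR_u hu this).1 hp'⟩
    have := (h.phi_biconvex hy).1.2 _ h1 _ h2 hs
    rw [e3] at this
    refine Or.inr ⟨_, this, h.wo_re hu.1 _ _⟩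

lemma nab_coconvex {J K : Set ι} (hKJ : K ⊆ J) {u y : V ≃ₗ[ℝ] V} (hu : u ∈ MinReps α s J K)
    (hy : y ∈ WJ α δ s K) : ConvexIn (DelJPosB α δ θ s J)
      (DelJPosB α δ θ s J \ nab α δ θ s J K u y) := by
  refine ⟨Set.diff_subset, ?_⟩
  have hmix : ∀ m n : ℤ, ∀ η ∈ DeloJ α s J, 0 < m → posR α n (u η) →
      n • δ + u η ∉ nab α δ θ s J K u y → (m + n) • δ + u η ∉ nab α δ θ s J K u y := by
    intro m n η hη hm hq hn hc
    rw [h.nab_re hu hη] at hc hn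
    push Not at hn
    rcases hc with ⟨h1, _⟩ | h1
    · exact hn.1 h1 hq
    · have hηK := (h.phi_re (DeloJ_sub hη) h1).1
      have := (h.phi_biconvex hy).2.2 (m • δ) ⟨h.mem_A_im.2 hm, h.phi_im hy m⟩ (n • δ + η)
        ⟨(h.mem_A_re (DeloJ_sub hη)).2 ⟨hηK, (h.posR_u hu hηK).1 hq⟩, hn.2⟩
      rw [← add_assoc, ← add_zsmul] at this
      exact (this h1.1).2 h1
  rintro v ⟨hvA, hv⟩ w ⟨hwA, hw⟩ hA
  refine ⟨hA, ?_⟩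
  rcases h.A_cases_u hu.1 hvA with ⟨m, hm, rfl⟩ | ⟨m, ε, hε, hp, rfl⟩
  · rcases h.A_cases_u hu.1 hwA with ⟨n, hn, rfl⟩ | ⟨n, η, hη, hq, rfl⟩
    · rw [← add_zsmul]; exact h.nab_im hu hy _
    · rw [← add_assoc, ← add_zsmul]
      exact hmix m n η hη hm hq hw
  · rcases h.A_cases_u hu.1 hwA with ⟨n, hn, rfl⟩ | ⟨n, η, hη, hq, rfl⟩
    · rw [add_comm, ← add_assoc, ← add_zsmul]
      exact hmix n m ε hε hn hp hv
    · have e : m • δ + u ε + (n • δ + u η) = (m + n) • δ + u (ε + η) := by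
        rw [add_zsmul, map_add]; abel
      rw [e] at hA ⊢
      intro hc
      rcases h.A_u hu.1 hε hη hA with ⟨e0, hk⟩ | ⟨hr, hp'⟩
      · rw [e0, map_zero, add_zero] at hc; exact h.nab_im hu hy _ hc
      · rw [h.nab_re hu hε] at hv
        rw [h.nab_re hu hη] at hw
        push Not at hv hw
        have nε : ε ∉ DeloKJneg α s J K := fun hh => hv.1 hh hp
        have nη : η ∉ DeloKJneg α s J K := fun hh => hw.1 hh hq
        rcases (h.nab_re hu hr).1 hc with ⟨h1, _⟩ | h1
        · exact h.not_N_add hε nε hη nη h1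
        · have hsK := (h.phi_re (DeloJ_sub hr) h1).1
          have hεK := h.not_N_K hε nε hη nη hsK
          have hηK := h.not_N_K hη nη hε nε (by rwa [add_comm])
          have := (h.phi_biconvex hy).2.2 (m • δ + ε)
            ⟨(h.mem_A_re (DeloJ_sub hε)).2 ⟨hεK, (h.posR_u hu hεK).1 hp⟩, hv.2⟩ (n • δ + η)
            ⟨(h.mem_A_re (DeloJ_sub hη)).2 ⟨hηK, (h.posR_u hu hηK).1 hq⟩, hw.2⟩
          have e3 : m • δ + ε + (n • δ + η) = (m + n) • δ + (ε + η) := by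
            rw [add_zsmul]; abel
          rw [e3] at this
          exact (this h1.1).2 h1

lemma nab_real {J K : Set ι} (hKJ : K ⊆ J) {u y : V ≃ₗ[ℝ] V} (hu : u ∈ MinReps α s J K)
    (hy : y ∈ WJ α δ s K) : nab α δ θ s J K u y ⊆ DelRePos α δ θ s := by
  intro v hv
  obtain ⟨m, ε, hε, hp, rfl, _⟩ := h.nab_cases hKJ hu hy hv
  have := DeloJ_sub (DeloJ_act hu.1 hε)
  exact ⟨h.mem_DelRe this, (h.mem_DelPos_re this).2 hp⟩

lemma nab_all {J K : Set ι} {u y : V ≃ₗ[ℝ] V} (hu : u ∈ MinReps α s J K)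
    (hy : y ∈ WJ α δ s K) {ε : V} (hε : ε ∈ DeloJ α s J) :
    (∀ m : ℤ, 0 < m → m • δ + u ε ∈ nab α δ θ s J K u y) ↔ ε ∈ DeloKJneg α s J K := by
  constructor
  · intro hall
    by_contra hN
    have hin : ∀ m : ℤ, 0 < m → m • δ + ε ∈ PhiJb α δ θ s K y := fun m hm =>
      ((h.nab_re hu hε).1 (hall m hm)).resolve_left fun hh => hN hh.1
    refine Set.infinite_of_injective_forall_mem (f := fun n : ℕ => ((n : ℤ) + 1) • δ + ε) ?_
      (s := PhiJb α δ θ s K y) (fun n => hin _ (by positivity)) (h.phi_finite hy)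
    intro a b e
    have d := h.dd_root (DeloJ_sub hε)
    have := (h.uniq d d e).1
    omega
  · intro hN m hm
    exact (h.nab_re hu hε).2 (Or.inl ⟨hN, Or.inl hm⟩)

lemma nab_infinite {J K : Set ι} (hKJ : K ⊂ J) {u y : V ≃ₗ[ℝ] V} (hu : u ∈ MinReps α s J K)
    (hy : y ∈ WJ α δ s K) : (nab α δ θ s J K u y).Infinite := by
  obtain ⟨j, hj, hjK⟩ := Set.exists_of_ssubset hKJ
  have hm : -α j ∈ DeloJ α s J := h.neg_memJ (alpha_memJ hj)
  have hN : -α j ∈ DeloKJneg α s J K := by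
    refine (h.N_iff hm).2 ⟨j, hjK, ?_⟩
    rw [map_neg, h.co_self]; norm_num
  refine Set.infinite_of_injective_forall_mem (f := fun n : ℕ => ((n : ℤ) + 1) • δ + u (-α j)) ?_
    (fun n => (h.nab_all hu hy hm).2 hN _ (by positivity))
  intro a b e
  have d := h.dd_root (DeloJ_sub (DeloJ_act hu.1 hm))
  have := (h.uniq d d e).1
  omega

lemma nab_finite {J : Set ι} {u y : V ≃ₗ[ℝ] V} (hu : u ∈ MinReps α s J J)
    (hy : y ∈ WJ α δ s J) : (nab α δ θ s J J u y).Finite := by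
  refine ((h.phi_finite hy).image u).subset ?_
  rintro v (hv | hv)
  · obtain ⟨m, _, ⟨ε, hε, rfl⟩, hp, rfl⟩ := (h.mem_brSet (h.NK_sub hu.1)).1 hv
    exact absurd hε.1.1 hε.1.2
  · exact hv

lemma inv_app (u : V ≃ₗ[ℝ] V) (v : V) : u (u⁻¹ v) = v := by
  change (u * u⁻¹) v = v
  rw [mul_inv_cancel]; rfl

lemma app_inv (u : V ≃ₗ[ℝ] V) (v : V) : u⁻¹ (u v) = v := by
  change (u⁻¹ * u) v = v
  rw [inv_mul_cancel]; rfl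

/-- the positive system of `u` is determined by `∇` -/
lemma u_pos {J K : Set ι} {u y : V ≃ₗ[ℝ] V} (hu : u ∈ MinReps α s J K)
    (hy : y ∈ WJ α δ s K) {ε : V} (hε : ε ∈ DeloJ α s J) :
    PosoComb α (u⁻¹ ε) ↔ (∀ m : ℤ, 0 < m → m • δ + -ε ∈ nab α δ θ s J K u y) ∨
      (¬ (∀ m : ℤ, 0 < m → m • δ + ε ∈ nab α δ θ s J K u y) ∧ PosoComb α ε) := by
  have hη : u⁻¹ ε ∈ DeloJ α s J := DeloJ_act (inv_mem hu.1) hε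
  have e := h.inv_app u ε
  set η := u⁻¹ ε with hηd
  rw [← e, ← map_neg, h.nab_all hu hy hη, h.nab_all hu hy (h.neg_memJ hη)]
  by_cases hK : η ∈ DeloJ α s K
  · rw [h.minrep_pos_iff hu hK]
    constructor
    · intro hp; exact Or.inr ⟨fun hh => hh.1.2 hK, hp⟩
    · rintro (hh | hh)
      · exact absurd (h.neg_memJ hK) hh.1.2
      · exact hh.2
  · constructor
    · intro hp
      exact Or.inl ⟨⟨h.neg_memJ hη, fun hh => hK (h.neg_memJ_iff.1 hh)⟩, by
        change PosoComb α (- -η); rwa [neg_neg]⟩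
    · rintro (hh | ⟨hh, _⟩)
      · have : PosoComb α (- -η) := hh.2
        rwa [neg_neg] at this
      · by_contra hp
        exact hh ⟨⟨hη, hK⟩, (h.not_pos (DeloJ_sub hη)).1 hp⟩

lemma nab_inj {J K K' : Set ι} (hKJ : K ⊆ J) (hKJ' : K' ⊆ J) {u y u' y' : V ≃ₗ[ℝ] V}
    (hu : u ∈ MinReps α s J K) (hy : y ∈ WJ α δ s K)
    (hu' : u' ∈ MinReps α s J K') (hy' : y' ∈ WJ α δ s K')
    (e : nab α δ θ s J K u y = nab α δ θ s J K' u' y') : K = K' ∧ u = u' ∧ y = y' := by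
  have huu : u = u' := by
    have hg : u'⁻¹ * u ∈ WoJ α s J := mul_mem (inv_mem hu'.1) hu.1
    have := (h.finSys J).eq_one (g := u'⁻¹ * u) (by rw [← WoJ_eq]; exact hg) (by
      rintro _ ⟨j, hj, rfl⟩
      refine ⟨DeloJ_act hg (alpha_memJ hj), ?_⟩
      have hm := DeloJ_act hu.1 (alpha_memJ (α := α) hj)
      change PosoComb α (u'⁻¹ (u (α j)))
      rw [h.u_pos hu' hy' hm, ← e, ← h.u_pos hu hy hm, h.app_inv]
      exact h.pos_alpha j)
    exact (inv_mul_eq_one.1 this).symm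
  subst huu
  have hN : DeloKJneg α s J K = DeloKJneg α s J K' := by
    ext ε
    constructor
    · intro hε
      rw [← h.nab_all hu' hy' hε.1.1, ← e, h.nab_all hu hy hε.1.1]; exact hε
    · intro hε
      rw [← h.nab_all hu hy hε.1.1, e, h.nab_all hu' hy' hε.1.1]; exact hε
  have hj : ∀ (L : Set ι) (j : ι), j ∈ J → (-α j ∈ DeloKJneg α s J L ↔ j ∉ L) := by
    intro L j hj
    constructor
    · intro hh hL
      exact hh.1.2 (h.neg_memJ (alpha_memJ hL))
    · intro hL
      refine (h.N_iff (h.neg_memJ (alpha_memJ hj))).2 ⟨j, hL, ?_⟩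
      rw [map_neg, h.co_self]; norm_num
  have hKK : K = K' := by
    ext j
    constructor
    · intro hk
      by_contra hc
      have := (hj K' j (hKJ hk)).2 hc
      rw [← hN] at this
      exact (hj K j (hKJ hk)).1 this hk
    · intro hk
      by_contra hc
      have := (hj K j (hKJ' hk)).2 hc
      rw [hN] at this
      exact (hj K' j (hKJ' hk)).1 this hk
  subst hKK
  refine ⟨rfl, rfl, h.phi_inj hy hy' ?_⟩
  have key : ∀ z z' : V ≃ₗ[ℝ] V, z ∈ WJ α δ s K → z' ∈ WJ α δ s K →
      nab α δ θ s J K u z = nab α δ θ s J K u z' → PhiJb α δ θ s K z ⊆ PhiJb α δ θ s K z' := by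
    intro z z' hz hz' ez v hv
    rcases h.A_cases hv.1 with ⟨m, hm, rfl⟩ | ⟨m, ε, hε, hp, rfl⟩
    · exact absurd hv (h.phi_im hz m)
    · have := (h.nab_re (y := z) hu (DeloJ_mono hKJ hε)).2 (Or.inr hv)
      rw [ez, h.nab_re hu (DeloJ_mono hKJ hε)] at this
      exact this.resolve_left fun hh => hh.1.1.2 hε
  exact Set.Subset.antisymm (key _ _ hy hy' e) (key _ _ hy' hy e.symm)

end AffineSetup
end affine
end

section
set_option linter.unusedSectionVars false
variable {ι V : Type*} [Fintype ι] [Nonempty ι] [AddCommGroup V] [Module ℝ V]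

section affine
variable {α : ι → V} {δ θ : V} {B : V →ₗ[ℝ] V →ₗ[ℝ] ℝ} {s : V → V ≃ₗ[ℝ] V}

namespace AffineSetup
variable (h : AffineSetup α δ θ B s)
include h

lemma A_pos {J : Set ι} {m : ℤ} {ε : V} (hε : ε ∈ DeloJ α s J) (hm : 0 < m) :
    m • δ + ε ∈ DelJPosB α δ θ s J := (h.mem_A_re (DeloJ_sub hε)).2 ⟨hε, Or.inl hm⟩

lemma opp_im {J : Set ι} {S : Set V} (hS : BiconvexIn (DelJPosB α δ θ s J) S)
    (hn : ∀ m : ℤ, m • δ ∉ S) {m n : ℤ} {ε : V} (hmn : 0 < m + n)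
    (h1 : m • δ + ε ∈ S) (h2 : n • δ + -ε ∈ S) : False := by
  have e : m • δ + ε + (n • δ + -ε) = (m + n) • δ := by rw [add_zsmul]; abel
  have := hS.1.2 _ h1 _ h2
  rw [e] at this
  exact hn _ (this (h.mem_A_im.2 hmn))

lemma pull_biconvex {J K : Set ι} (hKJ : K ⊆ J) {u : V ≃ₗ[ℝ] V} (hu : u ∈ MinReps α s J K)
    {S : Set V} (hS : BiconvexIn (DelJPosB α δ θ s J) S) :
    BiconvexIn (DelJPosB α δ θ s K) {v | v ∈ DelJPosB α δ θ s K ∧ u v ∈ S} := by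
  refine ⟨⟨fun v hv => hv.1, ?_⟩, ⟨fun v hv => hv.1, ?_⟩⟩
  · rintro v ⟨hv, hv'⟩ w ⟨hw, hw'⟩ hA
    refine ⟨hA, ?_⟩
    have := hS.1.2 _ hv' _ hw'
    rw [← map_add] at this
    exact this (h.u_A hKJ hu hA)
  · rintro v ⟨hv, hv'⟩ w ⟨hw, hw'⟩ hA
    refine ⟨hA, fun hc => ?_⟩
    have := hS.2.2 (u v) ⟨h.u_A hKJ hu hv, fun hh => hv' ⟨hv, hh⟩⟩ (u w)
      ⟨h.u_A hKJ hu hw, fun hh => hw' ⟨hw, hh⟩⟩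
    rw [← map_add] at this
    exact (this (h.u_A hKJ hu hA)).2 hc.2

lemma nab_surj {J : Set ι} {S : Set V} (hS : BiconvexIn (DelJPosB α δ θ s J) S)
    (hn : ∀ m : ℤ, m • δ ∉ S) :
    ∃ K, K ⊆ J ∧ ∃ u ∈ MinReps α s J K, ∃ y ∈ WJ α δ s K, S = nab α δ θ s J K u y := by
  let Q : Set V := {ε | ε ∈ DeloJ α s J ∧ ∃ m : ℤ, 0 < m ∧ m • δ + ε ∉ S}
  have hQc : ∀ ε ∈ Q, ∀ η ∈ Q, ε + η ∈ DeloJ α s J → ε + η ∈ Q := by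
    rintro ε ⟨hε, m, hm, h1⟩ η ⟨hη, n, hn', h2⟩ hs
    refine ⟨hs, m + n, by omega, ?_⟩
    have e : m • δ + ε + (n • δ + η) = (m + n) • δ + (ε + η) := by
      rw [add_zsmul]; abel
    have := hS.2.2 _ ⟨h.A_pos hε hm, h1⟩ _ ⟨h.A_pos hη hn', h2⟩
    rw [e] at this
    exact (this (h.A_pos hs (by omega))).2
  have hall : ∀ ε ∈ DeloJ α s J, ε ∉ Q → ∀ m : ℤ, posR α m ε → m • δ + ε ∈ S := by
    intro ε hε hq m hp
    have hpos : ∀ k : ℤ, 0 < k → k • δ + ε ∈ S := by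
      intro k hk
      by_contra hc
      exact hq ⟨hε, k, hk, hc⟩
    refine h.init_seg hS hn hε (n := m) (m := m + 1) (by omega) (hpos _ ?_) hp
    rcases hp with hp | hp <;> omega
  have hQn : ∀ ε ∈ DeloJ α s J, ε ∈ Q ∨ -ε ∈ Q := by
    intro ε hε
    by_contra! hc
    exact h.opp_im hS hn (m := 1) (n := 1) (by norm_num)
      (hall _ hε hc.1 1 (Or.inl one_pos)) (hall _ (h.neg_memJ hε) hc.2 1 (Or.inl one_pos))
  obtain ⟨K, hKJ, u, hu, huQ⟩ := h.parabolic hQc hQn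
  let S' : Set V := {v | v ∈ DelJPosB α δ θ s K ∧ u v ∈ S}
  have hS' := h.pull_biconvex hKJ hu hS
  have hbd : ∀ ε ∈ DeloJ α s K, ∃ M : ℤ, ∀ m : ℤ, m • δ + u ε ∈ S → m ≤ M := by
    intro ε hε
    have hεJ := DeloJ_mono hKJ hε
    have : u ε ∈ Q := by
      by_contra hc
      exact ((huQ ε hεJ).1 hc).1.2 hε
    obtain ⟨hr, M, hM, hM'⟩ := this
    refine ⟨M, fun m hm => ?_⟩
    by_contra! hlt
    exact hM' (h.init_seg hS hn hr hlt.le hm (Or.inl hM))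
  have hfin : S'.Finite := by
    choose! M hM using hbd
    have hf : (DeloJ α s K).Finite := h.finite.subset DeloJ_sub
    refine (hf.biUnion (t := fun ε => (fun m : ℤ => m • δ + ε) '' Set.Icc 0 (M ε))
      (fun ε _ => (Set.finite_Icc 0 (M ε)).image _)).subset ?_
    rintro v ⟨hv, hv'⟩
    rcases h.A_cases hv with ⟨m, hm, rfl⟩ | ⟨m, ε, hε, hp, rfl⟩
    · rw [h.wo_im hu.1] at hv'; exact absurd hv' (hn m)
    · rw [h.wo_re hu.1] at hv'
      refine Set.mem_biUnion hε ⟨m, ⟨?_, hM ε hε m hv'⟩, rfl⟩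
      rcases hp with hp | hp <;> omega
  obtain ⟨y, hy, hyS⟩ := h.fin_classify _ S' rfl hS' hfin
  refine ⟨K, hKJ, u, hu, y, hy, ?_⟩
  have key : ∀ v ∈ DelJPosB α δ θ s J, (v ∈ S ↔ v ∈ nab α δ θ s J K u y) := by
    intro v hv
    rcases h.A_cases_u hu.1 hv with ⟨m, hm, rfl⟩ | ⟨m, ε, hε, hp, rfl⟩
    · exact iff_of_false (hn m) (h.nab_im hu hy m)
    · rw [h.nab_re hu hε]
      have huε := DeloJ_act hu.1 hε
      by_cases hN : ε ∈ DeloKJneg α s J K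
      · exact iff_of_true (hall _ huε ((huQ ε hε).2 hN) m hp) (Or.inl ⟨hN, hp⟩)
      · rw [← hyS]
        by_cases hK : ε ∈ DeloJ α s K
        · constructor
          · intro hh
            refine Or.inr ⟨(h.mem_A_re (DeloJ_sub hε)).2 ⟨hK, (h.posR_u hu hK).1 hp⟩, ?_⟩
            rwa [h.wo_re hu.1]
          · rintro (hh | hh)
            · exact absurd hh.1 hN
            · have := hh.2
              rwa [h.wo_re hu.1] at this
        · refine iff_of_false ?_ ?_
          · intro hh
            have hN' : -ε ∈ DeloKJneg α s J K := by
              refine ⟨⟨h.neg_memJ hε, fun hc => hK (h.neg_memJ_iff.1 hc)⟩, ?_⟩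
              change PosoComb α (- -ε)
              rw [neg_neg]
              by_contra hc
              exact hN ⟨⟨hε, hK⟩, (h.not_pos (DeloJ_sub hε)).1 hc⟩
            have hm1 := hall _ (DeloJ_act hu.1 (h.neg_memJ hε)) ((huQ _ (h.neg_memJ hε)).2 hN') 1
              (Or.inl one_pos)
            rw [map_neg] at hm1
            refine h.opp_im hS hn ?_ hh hm1
            rcases hp with hp | hp <;> omega
          · rintro (hh | hh)
            · exact hN hh.1
            · exact hK ((h.mem_A_re (DeloJ_sub hε)).1 hh.1).1
  ext v
  exact ⟨fun hv => (key v (hS.1.1 hv)).1 hv, fun hv => (key v (h.nab_sub hKJ hu hv)).2 hv⟩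

end AffineSetup
end affine

/-- Theorem 6.7: the assignment `(K, u, y) ↦ ∇_J(K, u, y) = Δ^K_J(u, −) ⊔ uΦ_K(y)` is a
bijection from `P̃_J = {(K, u, y) | K ⊆ J, u ∈ ∘W^K_J, y ∈ W_K}` onto `𝔅_J ⊔ 𝔅^∞_J`,
mapping `P_J = {(K, u, y) ∈ P̃_J | K ⊊ J}` onto `𝔅^∞_J`. -/
theorem statement17 (α : ι → V) (δ θ : V) (B : V →ₗ[ℝ] V →ₗ[ℝ] ℝ) (s : V → V ≃ₗ[ℝ] V)
    (h : AffineSetup α δ θ B s) (J : Set ι) (hJ : J.Nonempty) :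
    Set.BijOn
      (fun t : Set ι × (V ≃ₗ[ℝ] V) × (V ≃ₗ[ℝ] V) =>
        DKJm α δ θ s J t.1 t.2.1 ∪ ⇑t.2.1 '' PhiJb α δ θ s t.1 t.2.2)
      {t : Set ι × (V ≃ₗ[ℝ] V) × (V ≃ₗ[ℝ] V) |
        t.1 ⊆ J ∧ t.2.1 ∈ MinReps α s J t.1 ∧ t.2.2 ∈ WJ α δ s t.1}
      {Bs : Set V | (Bs.Finite ∧ BiconvexIn (DelJPosB α δ θ s J) Bs) ∨
        (Bs.Infinite ∧ BiconvexIn (DelJPosB α δ θ s J) Bs ∧ Bs ⊆ DelRePos α δ θ s)} ∧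
    (fun t : Set ι × (V ≃ₗ[ℝ] V) × (V ≃ₗ[ℝ] V) =>
        DKJm α δ θ s J t.1 t.2.1 ∪ ⇑t.2.1 '' PhiJb α δ θ s t.1 t.2.2) ''
      {t : Set ι × (V ≃ₗ[ℝ] V) × (V ≃ₗ[ℝ] V) |
        t.1 ⊂ J ∧ t.2.1 ∈ MinReps α s J t.1 ∧ t.2.2 ∈ WJ α δ s t.1} =
      {Bs : Set V | Bs.Infinite ∧ BiconvexIn (DelJPosB α δ θ s J) Bs ∧
        Bs ⊆ DelRePos α δ θ s} := by
  have hre : ∀ S : Set V, S ⊆ DelRePos α δ θ s → ∀ m : ℤ, m • δ ∉ S := by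
    intro S hS m hm
    obtain ⟨n, ε, hε, e⟩ := (hS hm).1
    exact h.uniq0 hε e
  refine ⟨⟨?_, ?_, ?_⟩, ?_⟩
  · rintro ⟨K, u, y⟩ ⟨hKJ, hu, hy⟩
    dsimp only at hKJ hu hy
    have hb : BiconvexIn (DelJPosB α δ θ s J) (nab α δ θ s J K u y) :=
      ⟨h.nab_convex hKJ hu hy, h.nab_coconvex hKJ hu hy⟩
    rcases (nab α δ θ s J K u y).finite_or_infinite with hf | hf
    · exact Or.inl ⟨hf, hb⟩
    · exact Or.inr ⟨hf, hb, h.nab_real hKJ hu hy⟩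
  · rintro ⟨K, u, y⟩ ⟨hKJ, hu, hy⟩ ⟨K', u', y'⟩ ⟨hKJ', hu', hy'⟩ e
    obtain ⟨rfl, rfl, rfl⟩ := h.nab_inj hKJ hKJ' hu hy hu' hy' e
    rfl
  · intro S hS
    have hb : BiconvexIn (DelJPosB α δ θ s J) S ∧ ∀ m : ℤ, m • δ ∉ S := by
      rcases hS with ⟨hf, hb⟩ | ⟨_, hb, hr⟩
      · exact ⟨hb, h.fin_no_im hb hf⟩
      · exact ⟨hb, hre S hr⟩
    obtain ⟨K, hKJ, u, hu, y, hy, e⟩ := h.nab_surj hb.1 hb.2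
    exact ⟨(K, u, y), ⟨hKJ, hu, hy⟩, e.symm⟩
  · ext S
    constructor
    · rintro ⟨⟨K, u, y⟩, ⟨hKJ, hu, hy⟩, rfl⟩
      exact ⟨h.nab_infinite hKJ hu hy,
        ⟨h.nab_convex hKJ.1 hu hy, h.nab_coconvex hKJ.1 hu hy⟩, h.nab_real hKJ.1 hu hy⟩
    · rintro ⟨hi, hb, hr⟩
      obtain ⟨K, hKJ, u, hu, y, hy, e⟩ := h.nab_surj hb (hre S hr)
      refine ⟨(K, u, y), ⟨hKJ.ssubset_of_ne ?_, hu, hy⟩, e.symm⟩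
      rintro rfl
      rw [e] at hi
      exact hi (h.nab_finite hu hy)

end
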